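/- arXiv:2205.14967 — 9 statements merged into one kernel-verified Lean document; each statement's English description precedes it below -/
import Mathlib

section
/- Let T be a spanning tree of a finite weighted graph G and let e, f ∈ E(T). If Cut_{T,G}(e,f) < Cut_{T,G}(g) for every tree edge g ∈ E(T) (i.e., the 2-respecting cut value of (e,f) is smaller than every 1-respecting cut value), then Cov_{T,G}(e,f) > Cov_{T,G}(e) / 2. -/
open Finset

variable {V : Type*}

/-- The graph edge `g` covers the tree edge `e`: every `T`-path between the
endpoints of `g` contains `e` (in a tree this path is unique). -/
def EdgeCoversIn (T : SimpleGraph V) (g e : Sym2 V) : Prop :=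
  ∀ u v : V, g = s(u, v) → ∀ p : T.Walk u v, p.IsPath → e ∈ p.edges

open scoped Classical in
/-- Cover value `Cov_{T,G}(e,f)`: total weight of edges of `G` covering both `e` and `f`. -/
noncomputable def covVal [Fintype V] (G T : SimpleGraph V) (w : Sym2 V → ℝ)
    (e f : Sym2 V) : ℝ :=
  ∑ g : Sym2 V,
    if g ∈ G.edgeSet ∧ EdgeCoversIn T g e ∧ EdgeCoversIn T g f then w g else 0

open scoped Classical in
/-- Cut value `Cut_{T,G}(e,f)`: total weight of edges of `G` covering exactly one of `e`, `f`. -/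
noncomputable def cutVal [Fintype V] (G T : SimpleGraph V) (w : Sym2 V → ℝ)
    (e f : Sym2 V) : ℝ :=
  ∑ g : Sym2 V,
    if g ∈ G.edgeSet ∧ Xor' (EdgeCoversIn T g e) (EdgeCoversIn T g f) then w g else 0

open scoped Classical in
/-- 1-respecting cut value `Cut_{T,G}(e)`: total weight of edges of `G` covering `e`. -/
noncomputable def cutVal1 [Fintype V] (G T : SimpleGraph V) (w : Sym2 V → ℝ)
    (e : Sym2 V) : ℝ :=
  ∑ g : Sym2 V, if g ∈ G.edgeSet ∧ EdgeCoversIn T g e then w g else 0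

theorem stmt1 [Fintype V] (G T : SimpleGraph V) (w : Sym2 V → ℝ)
    (hw : ∀ g ∈ G.edgeSet, 0 < w g)
    (hle : T ≤ G) (hT : T.IsTree)
    (e f : Sym2 V) (he : e ∈ T.edgeSet) (hf : f ∈ T.edgeSet)
    (hsmall : ∀ g ∈ T.edgeSet, cutVal G T w e f < cutVal1 G T w g) :
    covVal G T w e f > covVal G T w e e / 2 := by
  have h := hsmall f hf
  have key : cutVal G T w e f + 2 * covVal G T w e f
      = covVal G T w e e + cutVal1 G T w f := by
    unfold cutVal covVal cutVal1
    rw [Finset.mul_sum, ← Finset.sum_add_distrib, ← Finset.sum_add_distrib]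
    refine Finset.sum_congr rfl fun g _ => ?_
    by_cases h1 : g ∈ G.edgeSet <;> by_cases h2 : EdgeCoversIn T g e <;>
      by_cases h3 : EdgeCoversIn T g f <;> simp [h1, h2, h3, Xor']
    ring
  linarith
end

section
/- (Monge property.) Let (G, T) be a path-to-path instance with first-path edges e_1, …, e_m and second-path edges f_1, …, f_ℓ. Then for all indices 1 ≤ i ≤ i' ≤ m and 1 ≤ j ≤ j' ≤ ℓ: Cut_{T,G}(e_i, f_j) + Cut_{T,G}(e_{i'}, f_{j'}) ≤ Cut_{T,G}(e_{i'}, f_j) + Cut_{T,G}(e_i, f_{j'}). -/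
open Finset

variable {V : Type*}

theorem aux_cross (T : SimpleGraph V) (c : ℤ → V) (L M : ℤ)
    (hinj : ∀ x y, L ≤ x → x ≤ M → L ≤ y → y ≤ M → c x = c y → x = y)
    (hAdj : ∀ x y : V, T.Adj x y → ∃ t, L ≤ t ∧ t < M ∧ s(x, y) = s(c t, c (t + 1)))
    (t : ℤ) {u v : V} (p : T.Walk u v) : ∀ x y, L ≤ x → x ≤ M → L ≤ y → y ≤ M →
      u = c x → v = c y → x ≤ t → t < y → s(c t, c (t + 1)) ∈ p.edges := by
  induction p with
  | nil =>
    intro x y h1 h2 h3 h4 hx hy h5 h6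
    have := hinj x y h1 h2 h3 h4 (hx.symm.trans hy)
    omega
  | cons h q ih =>
    intro x y h1 h2 h3 h4 hx hy h5 h6
    obtain ⟨t', ht1, ht2, he⟩ := hAdj _ _ h
    rw [SimpleGraph.Walk.edges_cons, List.mem_cons]
    by_cases htt : t' = t
    · left; rw [he, htt]
    right
    rcases Sym2.eq_iff.1 he with ⟨e1, e2⟩ | ⟨e1, e2⟩
    · have := hinj x t' h1 h2 ht1 ht2.le (hx.symm.trans e1)
      exact ih (t' + 1) y (by omega) (by omega) h3 h4 e2 hy (by omega) h6
    · have := hinj x (t' + 1) h1 h2 (by omega) (by omega) (hx.symm.trans e1)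
      exact ih t' y (by omega) (by omega) h3 h4 e2 hy (by omega) h6

theorem aux_walk (T : SimpleGraph V) (c : ℤ → V) (L M : ℤ)
    (hAdj : ∀ t, L ≤ t → t < M → T.Adj (c t) (c (t + 1)))
    (x : ℤ) (hx : L ≤ x) (n : ℕ) : x + n ≤ M →
      ∃ p : T.Walk (c x) (c (x + n)), ∀ e ∈ p.edges, ∃ t, x ≤ t ∧ t < x + n ∧
        e = s(c t, c (t + 1)) := by
  induction n with
  | zero =>
    intro _
    have : c (x + (0 : ℕ)) = c x := by simp
    rw [this]
    exact ⟨SimpleGraph.Walk.nil, by simp⟩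
  | succ n ih =>
    intro h
    push_cast at h
    obtain ⟨p, hp⟩ := ih (by omega)
    have : c (x + (n + 1 : ℕ)) = c (x + n + 1) := by push_cast; rw [add_assoc]
    rw [this]
    refine ⟨p.concat (hAdj (x + n) (by omega) (by omega)), ?_⟩
    intro e he
    rw [SimpleGraph.Walk.edges_concat, List.concat_eq_append, List.mem_append] at he
    rcases he with he | he
    · obtain ⟨t, h1, h2, h3⟩ := hp e he
      exact ⟨t, h1, by push_cast; omega, h3⟩
    · exact ⟨x + n, by omega, by push_cast; omega, by simpa using he⟩

theorem aux_cover (T : SimpleGraph V) (c : ℤ → V) (L M : ℤ)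
    (hinj : ∀ x y, L ≤ x → x ≤ M → L ≤ y → y ≤ M → c x = c y → x = y)
    (hAdj : ∀ x y : V, T.Adj x y ↔ ∃ t, L ≤ t ∧ t < M ∧ s(x, y) = s(c t, c (t + 1)))
    (x y t : ℤ) (hx : L ≤ x) (hxy : x ≤ y) (hy : y ≤ M) (ht : L ≤ t) (ht' : t < M) :
    EdgeCoversIn T s(c x, c y) s(c t, c (t + 1)) ↔ x ≤ t ∧ t < y := by
  classical
  constructor
  · intro h
    obtain ⟨n, hn⟩ := Int.le.dest hxy
    obtain ⟨p, hp⟩ := aux_walk T c L M (fun t h1 h2 => (hAdj _ _).2 ⟨t, h1, h2, rfl⟩) x hx n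
      (by omega)
    have h1 := h (c x) (c (x + n)) (by rw [hn]) p.bypass p.bypass_isPath
    obtain ⟨t', h2, h3, h4⟩ := hp _ (p.edges_bypass_subset h1)
    rcases Sym2.eq_iff.1 h4 with ⟨e1, e2⟩ | ⟨e1, e2⟩
    · have := hinj t t' (by omega) (by omega) (by omega) (by omega) e1
      omega
    · have := hinj t (t' + 1) (by omega) (by omega) (by omega) (by omega) e1
      have := hinj (t + 1) t' (by omega) (by omega) (by omega) (by omega) e2
      omega
  · rintro ⟨h1, h2⟩ u v huv p -
    rcases Sym2.eq_iff.1 huv with ⟨e1, e2⟩ | ⟨e1, e2⟩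
    · exact aux_cross T c L M hinj (fun a b => (hAdj a b).1) t p x y hx (by omega) (by omega) hy
        e1.symm e2.symm h1 h2
    · have := aux_cross T c L M hinj (fun a b => (hAdj a b).1) t p.reverse x y hx (by omega)
        (by omega) hy e1.symm e2.symm h1 h2
      simpa using this

theorem aux_surj (T : SimpleGraph V) (c : ℤ → V) (L M : ℤ)
    (hAdj : ∀ x y : V, T.Adj x y → ∃ t, L ≤ t ∧ t < M ∧ s(x, y) = s(c t, c (t + 1)))
    {u v : V} (p : T.Walk u v) : (∃ x, L ≤ x ∧ x ≤ M ∧ u = c x) →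
      ∃ x, L ≤ x ∧ x ≤ M ∧ v = c x := by
  induction p with
  | nil => exact id
  | cons h q ih =>
    intro _
    obtain ⟨t', ht1, ht2, he⟩ := hAdj _ _ h
    apply ih
    rcases Sym2.eq_iff.1 he with ⟨e1, e2⟩ | ⟨e1, e2⟩
    · exact ⟨t' + 1, by omega, by omega, e2⟩
    · exact ⟨t', by omega, by omega, e2⟩

theorem aux_monge [Fintype V] (G T : SimpleGraph V) (w : Sym2 V → ℝ)
    (hw : ∀ g ∈ G.edgeSet, 0 < w g) (hT : T.Connected) (c : ℤ → V) (L M : ℤ)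
    (hL : L ≤ 0) (hM : 0 ≤ M)
    (hinj : ∀ x y, L ≤ x → x ≤ M → L ≤ y → y ≤ M → c x = c y → x = y)
    (hAdj : ∀ x y : V, T.Adj x y ↔ ∃ t, L ≤ t ∧ t < M ∧ s(x, y) = s(c t, c (t + 1)))
    (i i' j j' : ℤ) (hi0 : 0 ≤ i) (hi : i ≤ i') (hiM : i' < M)
    (hj0 : j < 0) (hj : j' ≤ j) (hjL : L ≤ j') :
    cutVal G T w s(c i, c (i + 1)) s(c j, c (j + 1)) +
      cutVal G T w s(c i', c (i' + 1)) s(c j', c (j' + 1)) ≤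
    cutVal G T w s(c i', c (i' + 1)) s(c j, c (j + 1)) +
      cutVal G T w s(c i, c (i + 1)) s(c j', c (j' + 1)) := by
  classical
  unfold cutVal
  rw [← Finset.sum_add_distrib, ← Finset.sum_add_distrib]
  apply Finset.sum_le_sum
  intro g _
  by_cases hg : g ∈ G.edgeSet
  swap
  · simp [hg]
  have hpos := hw g hg
  have key : ∃ x y, L ≤ x ∧ x ≤ y ∧ y ≤ M ∧ g = s(c x, c y) := by
    induction g using Sym2.ind with
    | _ u v =>
      have hs : ∀ v, ∃ x, L ≤ x ∧ x ≤ M ∧ v = c x := fun v => by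
        obtain ⟨p⟩ := hT.preconnected (c 0) v
        exact aux_surj T c L M (fun a b => (hAdj a b).1) p ⟨0, hL, hM, rfl⟩
      obtain ⟨x, h1, h2, rfl⟩ := hs u
      obtain ⟨y, h3, h4, rfl⟩ := hs v
      rcases le_total x y with h | h
      · exact ⟨x, y, h1, h, h4, rfl⟩
      · exact ⟨y, x, h3, h, h2, Sym2.eq_swap⟩
  obtain ⟨x, y, h1, h2, h3, rfl⟩ := key
  have hc := fun t ht ht' => aux_cover T c L M hinj hAdj x y t h1 h2 h3 ht ht'
  simp only [hg, true_and]
  rw [hc i (by omega) (by omega), hc i' (by omega) (by omega), hc j (by omega) (by omega),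
    hc j' (by omega) (by omega)]
  simp only [Xor', xor_def]
  split_ifs <;> first | linarith | (exfalso; omega)

/-- Monge property for path-to-path instances.  The spanning tree `T` of `G` is rooted at
`r` and consists of two vertex-disjoint descending paths attached to `r`:
the first with vertex chain `a 0 = r, a 1, …, a m` (so its edges are
`e_i = s(a (i-1), a i)` in order of increasing depth) and the second with vertex chain
`b 0 = r, b 1, …, b ℓ`. -/
theorem stmt2 [Fintype V] (G T : SimpleGraph V) (w : Sym2 V → ℝ)
    (hw : ∀ g ∈ G.edgeSet, 0 < w g)
    (hle : T ≤ G) (hT : T.IsTree)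
    (r : V) (m ℓ : ℕ)
    (a : Fin (m + 1) → V) (b : Fin (ℓ + 1) → V)
    (ha0 : a 0 = r) (hb0 : b 0 = r)
    (hainj : Function.Injective a) (hbinj : Function.Injective b)
    (hdisj : ∀ i j, a i = b j → a i = r)
    (hAdj : ∀ x y : V, T.Adj x y ↔
      (∃ i : Fin m, s(x, y) = s(a i.castSucc, a i.succ)) ∨
      (∃ j : Fin ℓ, s(x, y) = s(b j.castSucc, b j.succ)))
    (i i' : Fin m) (j j' : Fin ℓ) (hi : i ≤ i') (hj : j ≤ j') :
    cutVal G T w (s(a i.castSucc, a i.succ)) (s(b j.castSucc, b j.succ)) +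
      cutVal G T w (s(a i'.castSucc, a i'.succ)) (s(b j'.castSucc, b j'.succ)) ≤
    cutVal G T w (s(a i'.castSucc, a i'.succ)) (s(b j.castSucc, b j.succ)) +
      cutVal G T w (s(a i.castSucc, a i.succ)) (s(b j'.castSucc, b j'.succ)) := by
  classical
  let c : ℤ → V := fun z => if 0 ≤ z then a (Fin.ofNat (m + 1) z.toNat)
    else b (Fin.ofNat (ℓ + 1) (-z).toNat)
  have ca : ∀ k : Fin (m + 1), c (k : ℕ) = a k := by
    intro k
    simp [c]
  have cb : ∀ k : Fin (ℓ + 1), c (-(k : ℕ)) = b k := by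
    intro k
    by_cases hk : k = 0
    · subst hk
      simp [c, ha0, hb0]
    · have : ¬ (0 : ℤ) ≤ -((k : ℕ) : ℤ) := by
        have : (k : ℕ) ≠ 0 := fun h => hk (Fin.ext h)
        omega
      simp only [c, this, if_false]
      simp
  have cz : ∀ x : ℤ, -(ℓ : ℤ) ≤ x → x ≤ m →
      (∃ k : Fin (m + 1), x = (k : ℕ)) ∨ (∃ k : Fin (ℓ + 1), x = -((k : ℕ) : ℤ)) := by
    intro x h1 h2
    rcases le_total 0 x with h | h
    · exact Or.inl ⟨⟨x.toNat, by omega⟩, by simp [h]⟩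
    · exact Or.inr ⟨⟨(-x).toNat, by omega⟩, by simp [h]⟩
  have hab : ∀ k k', a k = b k' → (k : ℕ) = 0 ∧ (k' : ℕ) = 0 := by
    intro k k' h
    have h0 := hdisj k k' h
    have h1 : k = 0 := hainj (h0.trans ha0.symm)
    have h2 : k' = 0 := hbinj ((h.symm.trans h0).trans hb0.symm)
    simp [h1, h2]
  have hinj : ∀ x y, -(ℓ : ℤ) ≤ x → x ≤ m → -(ℓ : ℤ) ≤ y → y ≤ m → c x = c y → x = y := by
    intro x y h1 h2 h3 h4 h
    rcases cz x h1 h2 with ⟨k, rfl⟩ | ⟨k, rfl⟩ <;> rcases cz y h3 h4 with ⟨k', rfl⟩ | ⟨k', rfl⟩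
    · rw [ca, ca] at h; rw [hainj h]
    · rw [ca, cb] at h; have := hab _ _ h; omega
    · rw [cb, ca] at h; have := hab _ _ h.symm; omega
    · rw [cb, cb] at h; rw [hbinj h]
  have ea : ∀ k : Fin m, s(a k.castSucc, a k.succ) = s(c (k : ℕ), c ((k : ℕ) + 1)) := by
    intro k
    have h1 := ca k.castSucc
    have h2 := ca k.succ
    simp only [Fin.val_castSucc, Fin.val_succ, Nat.cast_add, Nat.cast_one] at h1 h2
    rw [h1, h2]
  have eb : ∀ k : Fin ℓ, s(b k.castSucc, b k.succ) =
      s(c (-((k : ℕ) : ℤ) - 1), c (-((k : ℕ) : ℤ) - 1 + 1)) := by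
    intro k
    have h1 := cb k.castSucc
    have h2 := cb k.succ
    simp only [Fin.val_castSucc, Fin.val_succ, Nat.cast_add, Nat.cast_one] at h1 h2
    rw [← h1, ← h2, Sym2.eq_swap]
    congr 3 <;> ring_nf
  have hAdj' : ∀ x y : V, T.Adj x y ↔
      ∃ t, -(ℓ : ℤ) ≤ t ∧ t < m ∧ s(x, y) = s(c t, c (t + 1)) := by
    intro x y
    rw [hAdj]
    constructor
    · rintro (⟨k, hk⟩ | ⟨k, hk⟩)
      · exact ⟨(k : ℕ), by omega, by omega, hk.trans (ea k)⟩
      · exact ⟨-((k : ℕ) : ℤ) - 1, by omega, by omega, hk.trans (eb k)⟩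
    · rintro ⟨t, h1, h2, h3⟩
      rcases le_or_gt 0 t with h | h
      · left
        refine ⟨⟨t.toNat, by omega⟩, ?_⟩
        rw [ea, h3]
        simp [h]
      · right
        refine ⟨⟨(-t - 1).toNat, by omega⟩, ?_⟩
        have : -(((-t - 1).toNat : ℕ) : ℤ) - 1 = t := by omega
        rw [eb, h3]
        simp only [this]
  have hi2 : (i : ℕ) ≤ i' := hi
  have hj2 : (j : ℕ) ≤ j' := hj
  rw [ea, ea, eb, eb]
  exact aux_monge G T w hw hT.connected c (-(ℓ : ℤ)) m (by omega) (by omega) hinj hAdj' _ _ _ _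
    (by omega) (by omega) (by omega) (by omega) (by omega) (by omega)
end

section
/- Let (G, T) be a path-to-path instance with first-path edges e_1, …, e_m and second-path edges f_1, …, f_ℓ. Fix any index a ∈ {1, …, m}, and let b ∈ {1, …, ℓ} be an index minimizing j ↦ Cut_{T,G}(e_a, f_j) (a 'best response' to e_a). Then there exists a pair (i*, j*) minimizing Cut_{T,G}(e_i, f_j) over all (i,j) ∈ {1,…,m} × {1,…,ℓ} that additionally satisfies either (i* ≤ a and j* ≤ b) or (i* ≥ a and j* ≥ b). -/
open Finset

variable {V : Type*}

theorem parity_aux {T : SimpleGraph V} {S : Set V} {e : Sym2 V}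
    [DecidableEq (Sym2 V)]
    (h : ∀ x y, T.Adj x y → (s(x, y) = e ↔ Xor (x ∈ S) (y ∈ S)))
    {u v : V} (p : T.Walk u v) : Odd (p.edges.count e) ↔ Xor (u ∈ S) (v ∈ S) := by
  induction p with
  | nil => simp [Xor]
  | @cons x y z hxy q ih =>
    have h1 := h x y hxy
    rw [SimpleGraph.Walk.edges_cons]
    by_cases he : s(x, y) = e
    · rw [he, List.count_cons_self, Nat.odd_add_one, ih]
      have := h1.1 he
      unfold Xor at *
      tauto
    · rw [List.count_cons_of_ne he, ih]
      have := fun k => he (h1.2 k)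
      unfold Xor at *
      tauto

theorem cov_iff {T : SimpleGraph V} (hT : T.IsTree) {S : Set V} {e : Sym2 V}
    (h : ∀ x y, T.Adj x y → (s(x, y) = e ↔ Xor (x ∈ S) (y ∈ S)))
    (u v : V) : EdgeCoversIn T s(u, v) e ↔ Xor (u ∈ S) (v ∈ S) := by
  classical
  constructor
  · intro hc
    obtain ⟨p, hp, -⟩ := hT.existsUnique_path u v
    have := hc u v rfl p hp
    rw [← parity_aux h p, List.count_eq_one_of_mem hp.isTrail.edges_nodup this]
    exact odd_one
  · intro hx u' v' huv p hp
    have hx' : Xor (u' ∈ S) (v' ∈ S) := by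
      rcases Sym2.eq_iff.1 huv with ⟨rfl, rfl⟩ | ⟨rfl, rfl⟩
      · exact hx
      · exact hx.symm
    rw [← parity_aux h p] at hx'
    exact List.count_pos_iff.1 hx'.pos

theorem cov_path {T : SimpleGraph V} (hT : T.IsTree) {r : V} {m ℓ : ℕ}
    {a : Fin (m + 1) → V} {b : Fin (ℓ + 1) → V}
    (ha0 : a 0 = r)
    (hainj : Function.Injective a)
    (hdisj : ∀ i j, a i = b j → a i = r)
    (hAdj : ∀ x y : V, T.Adj x y ↔
      (∃ i : Fin m, s(x, y) = s(a i.castSucc, a i.succ)) ∨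
      (∃ j : Fin ℓ, s(x, y) = s(b j.castSucc, b j.succ)))
    (i : Fin m) (u v : V) : EdgeCoversIn T s(u, v) s(a i.castSucc, a i.succ) ↔
      Xor (∃ k, i.castSucc < k ∧ u = a k) (∃ k, i.castSucc < k ∧ v = a k) := by
  refine cov_iff hT (S := {x | ∃ k, i.castSucc < k ∧ x = a k}) ?_ u v
  have ma : ∀ k, a k ∈ {x | ∃ k, i.castSucc < k ∧ x = a k} ↔ i.castSucc < k := by
    intro k
    constructor
    · rintro ⟨k', h, e⟩
      rwa [hainj e]
    · intro h
      exact ⟨k, h, rfl⟩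
  have mb : ∀ k, b k ∉ {x | ∃ k, i.castSucc < k ∧ x = a k} := by
    rintro k ⟨k', h, e⟩
    have := hdisj _ _ e.symm
    rw [← ha0] at this
    rw [hainj this] at h
    exact absurd h (Fin.not_lt_zero _)
  have key : ∀ x y x' y', s(x, y) = s(x', y') →
      (s(x', y') = s(a i.castSucc, a i.succ) ↔ Xor (x' ∈ {x | ∃ k, i.castSucc < k ∧ x = a k}) (y' ∈ {x | ∃ k, i.castSucc < k ∧ x = a k})) →
      (s(x, y) = s(a i.castSucc, a i.succ) ↔ Xor (x ∈ {x | ∃ k, i.castSucc < k ∧ x = a k}) (y ∈ {x | ∃ k, i.castSucc < k ∧ x = a k})) := by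
    intro x y x' y' h h2
    rw [h, h2]
    rcases Sym2.eq_iff.1 h with ⟨rfl, rfl⟩ | ⟨rfl, rfl⟩
    · rfl
    · rw [xor_comm]
  intro x y hxy
  rcases (hAdj x y).1 hxy with ⟨k, hk⟩ | ⟨k, hk⟩
  · refine key _ _ _ _ hk ?_
    rw [ma, ma, Sym2.eq_iff, hainj.eq_iff, hainj.eq_iff, hainj.eq_iff, hainj.eq_iff]
    simp only [Fin.ext_iff, Fin.lt_def, Fin.val_castSucc, Fin.val_succ, Xor]
    omega
  · refine key _ _ _ _ hk ?_
    constructor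
    · intro h
      exfalso
      have : a i.succ ∈ s(b k.castSucc, b k.succ) := by rw [h]; simp
      have h3 : a i.succ ∈ {x | ∃ k, i.castSucc < k ∧ x = a k} := (ma _).2 Fin.castSucc_lt_succ
      rcases Sym2.mem_iff.1 this with h | h <;> rw [h] at h3 <;> exact mb _ h3
    · rintro (⟨h, -⟩ | ⟨h, -⟩) <;> exact absurd h (mb _)

theorem cov_mono {T : SimpleGraph V} (hT : T.IsTree) {r : V} {m ℓ : ℕ}
    {a : Fin (m + 1) → V} {b : Fin (ℓ + 1) → V}
    (ha0 : a 0 = r) (hb0 : b 0 = r)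
    (hainj : Function.Injective a) (hbinj : Function.Injective b)
    (hdisj : ∀ i j, a i = b j → a i = r)
    (hAdj : ∀ x y : V, T.Adj x y ↔
      (∃ i : Fin m, s(x, y) = s(a i.castSucc, a i.succ)) ∨
      (∃ j : Fin ℓ, s(x, y) = s(b j.castSucc, b j.succ)))
    {i i' : Fin m} (hi : i ≤ i') (j : Fin ℓ) (g : Sym2 V)
    (h1 : EdgeCoversIn T g s(a i'.castSucc, a i'.succ))
    (h2 : EdgeCoversIn T g s(b j.castSucc, b j.succ)) :
    EdgeCoversIn T g s(a i.castSucc, a i.succ) := by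
  induction g with
  | _ u v =>
  rw [cov_path hT ha0 hainj hdisj hAdj] at h1 ⊢
  rw [cov_path hT hb0 hbinj (b := a) (fun i j h => by rw [h]; exact hdisj _ _ h.symm)
    (fun x y => (hAdj x y).trans or_comm)] at h2
  have mono : ∀ x, (∃ k, i'.castSucc < k ∧ x = a k) → (∃ k, i.castSucc < k ∧ x = a k) := by
    rintro x ⟨k, hk, e⟩
    exact ⟨k, lt_of_le_of_lt (by simpa using hi) hk, e⟩
  have dis : ∀ x, (∃ k, i.castSucc < k ∧ x = a k) → ¬ (∃ k, j.castSucc < k ∧ x = b k) := by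
    rintro x ⟨k, hk, e⟩ ⟨k', hk', e'⟩
    have := hdisj k k' (e ▸ e')
    rw [← ha0] at this
    rw [hainj this] at hk
    exact absurd hk (Fin.not_lt_zero _)
  have m1 := mono u
  have m2 := mono v
  have d1 := dis u
  have d2 := dis v
  clear mono dis
  unfold Xor at h1 h2 ⊢
  generalize (∃ k, i.castSucc < k ∧ u = a k) = P1 at *
  generalize (∃ k, i.castSucc < k ∧ v = a k) = P2 at *
  generalize (∃ k, i'.castSucc < k ∧ u = a k) = P3 at *
  generalize (∃ k, i'.castSucc < k ∧ v = a k) = P4 at *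
  generalize (∃ k, j.castSucc < k ∧ u = b k) = P5 at *
  generalize (∃ k, j.castSucc < k ∧ v = b k) = P6 at *
  clear hAdj hdisj hi
  tauto

theorem cut_monge [Fintype V] (G : SimpleGraph V) {T : SimpleGraph V} (w : Sym2 V → ℝ)
    (hw : ∀ g ∈ G.edgeSet, 0 < w g) (hT : T.IsTree) {r : V} {m ℓ : ℕ}
    {a : Fin (m + 1) → V} {b : Fin (ℓ + 1) → V}
    (ha0 : a 0 = r) (hb0 : b 0 = r)
    (hainj : Function.Injective a) (hbinj : Function.Injective b)
    (hdisj : ∀ i j, a i = b j → a i = r)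
    (hAdj : ∀ x y : V, T.Adj x y ↔
      (∃ i : Fin m, s(x, y) = s(a i.castSucc, a i.succ)) ∨
      (∃ j : Fin ℓ, s(x, y) = s(b j.castSucc, b j.succ)))
    {i i' : Fin m} (hi : i ≤ i') {j j' : Fin ℓ} (hj : j ≤ j') :
    cutVal G T w s(a i.castSucc, a i.succ) s(b j.castSucc, b j.succ) +
    cutVal G T w s(a i'.castSucc, a i'.succ) s(b j'.castSucc, b j'.succ) ≤
    cutVal G T w s(a i.castSucc, a i.succ) s(b j'.castSucc, b j'.succ) +
    cutVal G T w s(a i'.castSucc, a i'.succ) s(b j.castSucc, b j.succ) := by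
  classical
  unfold cutVal
  rw [← Finset.sum_add_distrib, ← Finset.sum_add_distrib]
  refine Finset.sum_le_sum fun g _ => ?_
  by_cases hg : g ∈ G.edgeSet
  swap
  · simp [hg]
  have hwg := hw g hg
  have A := fun j => cov_mono hT ha0 hb0 hainj hbinj hdisj hAdj hi j g
  have B := fun i => cov_mono hT hb0 ha0 hbinj hainj
    (fun i j h => by rw [h]; exact hdisj _ _ h.symm)
    (fun x y => (hAdj x y).trans or_comm) hj i g
  have A1 := A j
  have A2 := A j'
  have B1 := B i
  have B2 := B i'
  clear A B
  by_cases p : EdgeCoversIn T g s(a i.castSucc, a i.succ) <;>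
  by_cases p' : EdgeCoversIn T g s(a i'.castSucc, a i'.succ) <;>
  by_cases q : EdgeCoversIn T g s(b j.castSucc, b j.succ) <;>
  by_cases q' : EdgeCoversIn T g s(b j'.castSucc, b j'.succ) <;>
  simp [p, p', q, q', Xor', Xor, hg] at A1 A2 B1 B2 ⊢ <;> linarith

/-- In a path-to-path instance (tree `T` rooted at `r` made of two vertex-disjoint
descending paths `a 0 = r, a 1, …, a m` and `b 0 = r, b 1, …, b ℓ`), fix an edge index
`ia` on the first path and let `jb` be a best response to it.  Then some minimizer of the
2-respecting cut value over all pairs lies entirely weakly above or entirely weakly below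
`(ia, jb)`. -/
theorem stmt3 [Fintype V] (G T : SimpleGraph V) (w : Sym2 V → ℝ)
    (hw : ∀ g ∈ G.edgeSet, 0 < w g)
    (hle : T ≤ G) (hT : T.IsTree)
    (r : V) (m ℓ : ℕ)
    (a : Fin (m + 1) → V) (b : Fin (ℓ + 1) → V)
    (ha0 : a 0 = r) (hb0 : b 0 = r)
    (hainj : Function.Injective a) (hbinj : Function.Injective b)
    (hdisj : ∀ i j, a i = b j → a i = r)
    (hAdj : ∀ x y : V, T.Adj x y ↔
      (∃ i : Fin m, s(x, y) = s(a i.castSucc, a i.succ)) ∨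
      (∃ j : Fin ℓ, s(x, y) = s(b j.castSucc, b j.succ)))
    (ia : Fin m) (jb : Fin ℓ)
    (hbest : ∀ j : Fin ℓ,
      cutVal G T w (s(a ia.castSucc, a ia.succ)) (s(b jb.castSucc, b jb.succ)) ≤
      cutVal G T w (s(a ia.castSucc, a ia.succ)) (s(b j.castSucc, b j.succ))) :
    ∃ (i' : Fin m) (j' : Fin ℓ),
      (∀ (i : Fin m) (j : Fin ℓ),
        cutVal G T w (s(a i'.castSucc, a i'.succ)) (s(b j'.castSucc, b j'.succ)) ≤
        cutVal G T w (s(a i.castSucc, a i.succ)) (s(b j.castSucc, b j.succ))) ∧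
      ((i' ≤ ia ∧ j' ≤ jb) ∨ (ia ≤ i' ∧ jb ≤ j')) := by
  have M := @cut_monge V _ G T w hw hT r m ℓ a b ha0 hb0 hainj hbinj hdisj hAdj
  have : Nonempty (Fin m × Fin ℓ) := ⟨(ia, jb)⟩
  obtain ⟨⟨i, j⟩, hmin⟩ := Finite.exists_min (fun p : Fin m × Fin ℓ =>
    cutVal G T w (s(a p.1.castSucc, a p.1.succ)) (s(b p.2.castSucc, b p.2.succ)))
  have hmin' := fun i' j' => hmin (i', j')
  simp only at hmin'
  have hb := hbest j
  rcases le_total i ia with h1 | h1 <;> rcases le_total j jb with h2 | h2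
  · exact ⟨i, j, hmin', Or.inl ⟨h1, h2⟩⟩
  · refine ⟨i, jb, fun x y => ?_, Or.inl ⟨h1, le_rfl⟩⟩
    have := M h1 h2
    have := hmin' x y
    linarith
  · refine ⟨i, jb, fun x y => ?_, Or.inr ⟨h1, le_rfl⟩⟩
    have := M h1 h2
    have := hmin' x y
    linarith
  · exact ⟨i, j, hmin', Or.inr ⟨h1, h2⟩⟩
end

section
/- (Separability of 2-respecting cut values in separable path-to-path instances.) Let G be a finite weighted graph with spanning tree T rooted at r, where T consists of r, a path P with vertices p_1, …, p_m (p_1 adjacent to r in T), a path Q with vertices q_1, …, q_ℓ (q_1 adjacent to r in T), and the two attachment tree edges {r, p_1} and {r, q_1}. Let E(P) := { {p_i, p_{i+1}} : 1 ≤ i < m } and E(Q) := { {q_i, q_{i+1}} : 1 ≤ i < ℓ } (the attachment edges excluded). Assume that G has no edge with one endpoint in {p_2, …, p_{m−1}} and the other endpoint in {q_2, …, q_{ℓ−1}} (i.e., all cross-path edges of G are incident to r, p_1, p_m, q_1, or q_ℓ). Then there exist functions F_P : E(P) → ℝ and F_Q : E(Q) → ℝ such that Cut_{T,G}(e, f)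 = F_P(e) + F_Q(f) for all e ∈ E(P) and f ∈ E(Q); consequently, the minimum of Cut_{T,G}(e, f) over E(P) × E(Q) equals (min over E(P) of F_P) + (min over E(Q) of F_Q). -/
open Finset

variable {V : Type*}

lemma aux_reach {H : SimpleGraph V} {n : ℕ} (c : Fin (n + 1) → V) (k : ℕ) (hk : k < n + 1)
    (h : ∀ i : Fin n, (i : ℕ) < k → H.Adj (c i.castSucc) (c i.succ)) :
    H.Reachable (c 0) (c ⟨k, hk⟩) := by
  induction k with
  | zero => exact SimpleGraph.Reachable.refl _
  | succ k ih =>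
    have h1 := ih (by omega) (fun i hi => h i (by omega))
    exact h1.trans (h ⟨k, by omega⟩ (by simp)).reachable

lemma aux_not_cover {T : SimpleGraph V} {e : Sym2 V} {x y : V}
    (h : (T.deleteEdges {e}).Reachable x y) : ¬ EdgeCoversIn T s(x, y) e := by
  classical
  obtain ⟨p, hp⟩ := h.exists_isPath
  intro hc
  have hle : T.deleteEdges {e} ≤ T := SimpleGraph.deleteEdges_le _
  have h2 := hc x y rfl (p.mapLe hle) (hp.mapLe hle)
  rw [SimpleGraph.Walk.edges_mapLe_eq_edges] at h2
  have := p.edges_subset_edgeSet h2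
  simp [SimpleGraph.edgeSet_deleteEdges] at this

lemma aux_cover_s4 {T : SimpleGraph V} {e : Sym2 V} {x y : V} (S : Set V)
    (hx : x ∈ S) (hy : y ∉ S)
    (h : ∀ u v, T.Adj u v → u ∈ S → v ∉ S → s(u, v) = e) : EdgeCoversIn T s(x, y) e := by
  have key : ∀ p : T.Walk x y, e ∈ p.edges := by
    intro p
    obtain ⟨d, hd, h1, h2⟩ := p.exists_boundary_dart S hx hy
    rw [← h _ _ d.adj h1 h2]
    exact List.mem_map_of_mem (f := SimpleGraph.Dart.edge) hd
  intro u v huv p _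
  rcases Sym2.eq_iff.1 huv with ⟨rfl, rfl⟩ | ⟨rfl, rfl⟩
  · exact key p
  · have := key p.reverse
    simpa using this

/-- edges along `a` of index at least `k` are not covered by things reachable otherwise -/
lemma aux_r_a {T : SimpleGraph V} {r : V} {m : ℕ}
    {a : Fin (m + 1) → V} (ha0 : a 0 = r) (hainj : Function.Injective a)
    (hadj : ∀ i : Fin m, T.Adj (a i.castSucc) (a i.succ))
    (i : Fin m) (k : Fin (m + 1)) (hk : (k : ℕ) ≤ i) :
    (T.deleteEdges {s(a i.castSucc, a i.succ)}).Reachable r (a k) := by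
  subst ha0
  refine aux_reach a k k.2 ?_
  intro j hj
  rw [SimpleGraph.deleteEdges_adj]
  refine ⟨hadj j, ?_⟩
  simp only [Set.mem_singleton_iff, Sym2.eq_iff, hainj.eq_iff, Fin.ext_iff, Fin.val_castSucc,
    Fin.val_succ]
  omega

lemma aux_r_b {T : SimpleGraph V} {r : V} {m ℓ : ℕ}
    {a : Fin (m + 1) → V} {b : Fin (ℓ + 1) → V} (ha0 : a 0 = r) (hb0 : b 0 = r)
    (hainj : Function.Injective a)
    (hdisj : ∀ i j, a i = b j → a i = r)
    (hadj : ∀ i : Fin ℓ, T.Adj (b i.castSucc) (b i.succ))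
    (i : Fin m) (k : Fin (ℓ + 1)) :
    (T.deleteEdges {s(a i.castSucc, a i.succ)}).Reachable r (b k) := by
  rw [← hb0]
  refine aux_reach b k k.2 ?_
  intro j hj
  rw [SimpleGraph.deleteEdges_adj]
  refine ⟨hadj j, ?_⟩
  have hne : ∀ j, a i.succ ≠ b j := by
    intro j hj
    have := hdisj _ _ hj
    rw [← ha0] at this
    exact Fin.succ_ne_zero _ (hainj this)
  simp only [Set.mem_singleton_iff, Sym2.eq_iff]
  rintro (⟨_, h⟩ | ⟨h, _⟩) <;> exact hne _ h.symm

lemma aux_last {T : SimpleGraph V} {r : V} {m ℓ : ℕ}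
    {a : Fin (m + 1) → V} {b : Fin (ℓ + 1) → V} (ha0 : a 0 = r)
    (hainj : Function.Injective a)
    (hdisj : ∀ i j, a i = b j → a i = r)
    (hAdj : ∀ x y : V, T.Adj x y →
      (∃ i : Fin m, s(x, y) = s(a i.castSucc, a i.succ)) ∨
      (∃ j : Fin ℓ, s(x, y) = s(b j.castSucc, b j.succ)))
    (i : Fin m) (k : Fin (m + 1)) (hk : (k : ℕ) = m) (l : Fin (ℓ + 1)) :
    EdgeCoversIn T s(a k, b l) s(a i.castSucc, a i.succ) := by
  have hne : ∀ (k : Fin (m + 1)) j, (i : ℕ) < k → a k ≠ b j := by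
    intro k j hk hj
    have := hdisj _ _ hj
    rw [← ha0] at this
    have := hainj this
    subst this
    simp at hk
  refine aux_cover_s4 {v | ∃ k : Fin (m + 1), (i : ℕ) < k ∧ v = a k} ⟨k, by omega, rfl⟩ ?_ ?_
  · rintro ⟨k', h1, h2⟩
    exact hne _ _ h1 h2.symm
  · rintro u v huv ⟨k, hk, rfl⟩ hv
    rcases hAdj _ _ huv with ⟨j, hj⟩ | ⟨j, hj⟩
    · rcases Sym2.eq_iff.1 hj with ⟨h1, h2⟩ | ⟨h1, h2⟩
      · have := hainj h1
        subst this
        exact absurd ⟨j.succ, by simp at hk ⊢; omega, h2⟩ hv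
      · have := hainj h1
        subst this
        have : ¬ (i : ℕ) < j := fun h => hv ⟨j.castSucc, by simpa using h, h2⟩
        have : j = i := by ext; simp at hk; omega
        rw [hj, this]
    · rcases Sym2.eq_iff.1 hj with ⟨h1, h2⟩ | ⟨h1, h2⟩ <;> exact absurd h1 (hne _ _ hk)

/-- Separability of 2-respecting cut values in separable path-to-path instances.
The spanning tree `T` of `G` is rooted at `r` and consists of the two attachment edges
`{r, a 1}`, `{r, b 1}` and the two vertex-disjoint descending paths with vertices
`p_i = a i` (1 ≤ i ≤ m) and `q_j = b j` (1 ≤ j ≤ ℓ).  The edges of `P` (attachment edge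
excluded) are `s(a i, a (i+1))` for `i : Fin m`, `i ≠ 0`, and similarly for `Q`.
If `G` has no edge joining an interior vertex `a i` (2 ≤ i ≤ m-1) with an interior
vertex `b j` (2 ≤ j ≤ ℓ-1), then the 2-respecting cut values separate as
`Cut(e,f) = F_P(e) + F_Q(f)`, and the minimum over all pairs splits accordingly. -/
theorem stmt4 [Fintype V] (G T : SimpleGraph V) (w : Sym2 V → ℝ)
    (hw : ∀ g ∈ G.edgeSet, 0 < w g)
    (hle : T ≤ G) (hT : T.IsTree)
    (r : V) (m ℓ : ℕ) (hm : 2 ≤ m) (hl : 2 ≤ ℓ)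
    (a : Fin (m + 1) → V) (b : Fin (ℓ + 1) → V)
    (ha0 : a 0 = r) (hb0 : b 0 = r)
    (hainj : Function.Injective a) (hbinj : Function.Injective b)
    (hdisj : ∀ i j, a i = b j → a i = r)
    (hAdj : ∀ x y : V, T.Adj x y ↔
      (∃ i : Fin m, s(x, y) = s(a i.castSucc, a i.succ)) ∨
      (∃ j : Fin ℓ, s(x, y) = s(b j.castSucc, b j.succ)))
    (hsep : ∀ (i : Fin (m + 1)) (j : Fin (ℓ + 1)),
      2 ≤ (i : ℕ) → (i : ℕ) ≤ m - 1 → 2 ≤ (j : ℕ) → (j : ℕ) ≤ ℓ - 1 →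
      s(a i, b j) ∉ G.edgeSet) :
    ∃ (FP : Fin m → ℝ) (FQ : Fin ℓ → ℝ),
      (∀ (i : Fin m) (j : Fin ℓ), (i : ℕ) ≠ 0 → (j : ℕ) ≠ 0 →
        cutVal G T w (s(a i.castSucc, a i.succ)) (s(b j.castSucc, b j.succ)) = FP i + FQ j) ∧
      sInf {x : ℝ | ∃ (i : Fin m) (j : Fin ℓ), (i : ℕ) ≠ 0 ∧ (j : ℕ) ≠ 0 ∧
          x = cutVal G T w (s(a i.castSucc, a i.succ)) (s(b j.castSucc, b j.succ))} =
        sInf {x : ℝ | ∃ i : Fin m, (i : ℕ) ≠ 0 ∧ x = FP i} +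
        sInf {x : ℝ | ∃ j : Fin ℓ, (j : ℕ) ≠ 0 ∧ x = FQ j} := by
  classical
  have haadj : ∀ i : Fin m, T.Adj (a i.castSucc) (a i.succ) :=
    fun i => (hAdj _ _).2 (Or.inl ⟨i, rfl⟩)
  have hbadj : ∀ i : Fin ℓ, T.Adj (b i.castSucc) (b i.succ) :=
    fun i => (hAdj _ _).2 (Or.inr ⟨i, rfl⟩)
  have hdisj' : ∀ i j, b i = a j → b i = r := fun i j h => by
    rw [h]; exact hdisj j i h.symm
  have hcov : ∀ v, (∃ k, v = a k) ∨ (∃ k, v = b k) := by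
    intro v
    by_contra hv
    obtain ⟨p⟩ := hT.1.preconnected r v
    obtain ⟨d, hd, h1, h2⟩ := p.exists_boundary_dart
      {v | (∃ k, v = a k) ∨ (∃ k, v = b k)} (Or.inl ⟨0, ha0.symm⟩) hv
    apply h2
    rcases (hAdj _ _).1 d.adj with ⟨j, hj⟩ | ⟨j, hj⟩ <;>
    rcases Sym2.eq_iff.1 hj with ⟨h1, h2⟩ | ⟨h1, h2⟩
    · exact Or.inl ⟨_, h2⟩
    · exact Or.inl ⟨_, h2⟩
    · exact Or.inr ⟨_, h2⟩
    · exact Or.inr ⟨_, h2⟩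
  -- mixed edges
  have hmix : ∀ k l, s(a k, b l) ∈ G.edgeSet →
      (∃ P : Prop, ∀ i : Fin m, (i : ℕ) ≠ 0 →
        (EdgeCoversIn T s(a k, b l) s(a i.castSucc, a i.succ) ↔ P)) ∨
      (∃ P : Prop, ∀ j : Fin ℓ, (j : ℕ) ≠ 0 →
        (EdgeCoversIn T s(a k, b l) s(b j.castSucc, b j.succ) ↔ P)) := by
    intro k l hG
    by_cases hk1 : (k : ℕ) ≤ 1
    · refine Or.inl ⟨False, fun i hi => iff_false_intro (aux_not_cover ?_)⟩
      exact (aux_r_a ha0 hainj haadj i k (by omega)).symm.trans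
        (aux_r_b ha0 hb0 hainj hdisj hbadj i l)
    by_cases hkm : (k : ℕ) = m
    · exact Or.inl ⟨True, fun i hi => iff_true_intro
        (aux_last ha0 hainj hdisj (fun x y => (hAdj x y).1) i k hkm l)⟩
    by_cases hl1 : (l : ℕ) ≤ 1
    · refine Or.inr ⟨False, fun i hi => iff_false_intro (aux_not_cover ?_)⟩
      exact (aux_r_b hb0 ha0 hbinj hdisj' haadj i k).symm.trans
        (aux_r_a hb0 hbinj hbadj i l (by omega))
    by_cases hll : (l : ℕ) = ℓ
    · refine Or.inr ⟨True, fun i hi => iff_true_intro ?_⟩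
      rw [Sym2.eq_swap (a := a k)]
      exact aux_last hb0 hbinj hdisj' (fun x y h => ((hAdj x y).1 h).symm) i l hll k
    exact absurd hG (hsep k l (by omega) (by omega) (by omega) (by omega))
  have hall : ∀ g ∈ G.edgeSet,
      (∃ P : Prop, ∀ i : Fin m, (i : ℕ) ≠ 0 →
        (EdgeCoversIn T g s(a i.castSucc, a i.succ) ↔ P)) ∨
      (∃ P : Prop, ∀ j : Fin ℓ, (j : ℕ) ≠ 0 →
        (EdgeCoversIn T g s(b j.castSucc, b j.succ) ↔ P)) := by
    intro g
    induction g using Sym2.ind with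
    | _ x y =>
    intro hG
    rcases hcov x with ⟨k, rfl⟩ | ⟨k, rfl⟩ <;> rcases hcov y with ⟨l, rfl⟩ | ⟨l, rfl⟩
    · exact Or.inr ⟨False, fun j hj => iff_false_intro (aux_not_cover
        ((aux_r_b hb0 ha0 hbinj hdisj' haadj j k).symm.trans
          (aux_r_b hb0 ha0 hbinj hdisj' haadj j l)))⟩
    · exact hmix k l hG
    · rw [Sym2.eq_swap] at hG ⊢
      exact hmix l k hG
    · exact Or.inl ⟨False, fun j hj => iff_false_intro (aux_not_cover
        ((aux_r_b ha0 hb0 hainj hdisj hbadj j k).symm.trans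
          (aux_r_b ha0 hb0 hainj hdisj hbadj j l)))⟩
  have hpt : ∀ g : Sym2 V, ∃ (α : Fin m → ℝ) (β : Fin ℓ → ℝ), ∀ (i : Fin m) (j : Fin ℓ),
      (i : ℕ) ≠ 0 → (j : ℕ) ≠ 0 →
      (if g ∈ G.edgeSet ∧ Xor' (EdgeCoversIn T g s(a i.castSucc, a i.succ))
        (EdgeCoversIn T g s(b j.castSucc, b j.succ)) then w g else 0) = α i + β j := by
    intro g
    by_cases hg : g ∈ G.edgeSet
    · rcases hall g hg with ⟨P, hP⟩ | ⟨P, hP⟩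
      · refine ⟨fun _ => 0, fun j => if Xor' P (EdgeCoversIn T g s(b j.castSucc, b j.succ))
          then w g else 0, fun i j hi hj => ?_⟩
        simp only [hP i hi, hg, true_and, zero_add]
      · refine ⟨fun i => if Xor' (EdgeCoversIn T g s(a i.castSucc, a i.succ)) P
          then w g else 0, fun _ => 0, fun i j hi hj => ?_⟩
        simp only [hP j hj, hg, true_and, add_zero]
    · exact ⟨fun _ => 0, fun _ => 0, fun i j _ _ => by simp [hg]⟩
  choose α β hαβ using hpt
  have hmain : ∀ (i : Fin m) (j : Fin ℓ), (i : ℕ) ≠ 0 → (j : ℕ) ≠ 0 →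
        cutVal G T w (s(a i.castSucc, a i.succ)) (s(b j.castSucc, b j.succ)) =
          (∑ g, α g i) + (∑ g, β g j) := by
    intro i j hi hj
    rw [← Finset.sum_add_distrib, cutVal]
    refine Finset.sum_congr (by congr!) fun g _ => ?_
    rw [← hαβ g i j hi hj]
  refine ⟨fun i => ∑ g, α g i, fun j => ∑ g, β g j, hmain, ?_⟩
  have hf1 : {x : ℝ | ∃ i : Fin m, (i : ℕ) ≠ 0 ∧ x = ∑ g, α g i}.Finite :=
    (Set.finite_range (fun i : Fin m => ∑ g, α g i)).subset
      (by rintro x ⟨i, _, rfl⟩; exact ⟨i, rfl⟩)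
  have hf2 : {x : ℝ | ∃ i : Fin ℓ, (i : ℕ) ≠ 0 ∧ x = ∑ g, β g i}.Finite :=
    (Set.finite_range (fun i : Fin ℓ => ∑ g, β g i)).subset
      (by rintro x ⟨i, _, rfl⟩; exact ⟨i, rfl⟩)
  have hn1 : {x : ℝ | ∃ i : Fin m, (i : ℕ) ≠ 0 ∧ x = ∑ g, α g i}.Nonempty :=
    ⟨_, ⟨1, by omega⟩, by simp, rfl⟩
  have hn2 : {x : ℝ | ∃ i : Fin ℓ, (i : ℕ) ≠ 0 ∧ x = ∑ g, β g i}.Nonempty :=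
    ⟨_, ⟨1, by omega⟩, by simp, rfl⟩
  refine Eq.trans ?_ (csInf_add hn1 hf1.bddBelow hn2 hf2.bddBelow)
  congr 1
  ext x
  rw [Set.mem_add]
  constructor
  · rintro ⟨i, j, hi, hj, rfl⟩
    exact ⟨_, ⟨i, hi, rfl⟩, _, ⟨j, hj, rfl⟩, (hmain i j hi hj).symm⟩
  · rintro ⟨_, ⟨i, hi, rfl⟩, _, ⟨j, hj, rfl⟩, rfl⟩
    exact ⟨i, j, hi, hj, (hmain i j hi hj).symm⟩
end

section
/- (Subtree projection preserves cover and cut values.) Let T be a spanning tree of a finite weighted graph G, and let S ⊆ V(G) be a set of vertices such that the induced subgraph T[S] is connected (hence a subtree of T). For x ∈ V(G), let π(x) denote the unique vertex of S nearest to x in T (the first vertex of S encountered on the T-path from x to S), with π(x) = x for x ∈ S. Let G' be the weighted multigraph on vertex set S containing, for each edge {u, v} ∈ E(G) with π(u) ≠ π(v), an edge {π(u), π(v)} of weight w({u,v}) (edges with π(u) = π(v) are discarded; parallel edges are kept, or equivalently their weights are summed). Then T[S] is a spanning tree of G', and for all e, f ∈ E(T[S]): Cov_{T[S],G'}(e,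 f) = Cov_{T,G}(e, f), Cut_{T[S],G'}(e, f) = Cut_{T,G}(e, f), and Cut_{T[S],G'}(e) = Cut_{T,G}(e). -/
open Finset

variable {V : Type*}

theorem coversIn_iff_aux (T : SimpleGraph V) (u v : V) (e : Sym2 V) :
    EdgeCoversIn T s(u, v) e ↔ ¬ (T.deleteEdges {e}).Reachable u v := by
  constructor
  · intro h hr
    obtain ⟨p, hp⟩ := hr.exists_isPath
    have h1 := h u v rfl (p.mapLe (T.deleteEdges_le {e})) (hp.mapLe _)
    rw [SimpleGraph.Walk.edges_mapLe_eq_edges] at h1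
    have h2 := p.edges_subset_edgeSet h1
    simp [SimpleGraph.edgeSet_deleteEdges] at h2
  · intro h x y hxy p hp
    by_contra hne
    have hr : (T.deleteEdges {e}).Reachable x y := ⟨p.toDeleteEdge e hne⟩
    rcases Sym2.eq_iff.1 hxy with ⟨rfl, rfl⟩ | ⟨rfl, rfl⟩
    · exact h hr
    · exact h hr.symm

theorem covers_not_diag_aux (T : SimpleGraph V) (g e : Sym2 V)
    (h : EdgeCoversIn T g e) : ¬ g.IsDiag := by
  induction g with | _ u v
  intro hd
  have hd : u = v := hd
  subst hd
  exact (coversIn_iff_aux T _ _ e).1 h (SimpleGraph.Reachable.refl _)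

theorem reach_proj_aux (T : SimpleGraph V) (hT : T.IsTree) (S : Set V) 
    (π : V → ↥S)
    (hπpath : ∀ (x : V) (p : T.Walk x ↑(π x)), p.IsPath →
      ∀ y ∈ p.support, y ∈ S → y = ↑(π x))
    (e : Sym2 ↥S) (he : e ∈ (T.induce S).edgeSet) (u : V) :
    (T.deleteEdges {Sym2.map Subtype.val e}).Reachable u (π u) := by
  induction e with | _ a b
  obtain ⟨p, hp⟩ := (hT.connected.preconnected u (π u)).exists_isPath
  refine ⟨p.toDeleteEdge _ ?_⟩
  intro hmem
  simp only [Sym2.map_mk] at hmem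
  have h1 := hπpath u p hp _ (p.fst_mem_support_of_mem_edges hmem) a.2
  have h2 := hπpath u p hp _ (p.snd_mem_support_of_mem_edges hmem) b.2
  have h3 : T.Adj a b := by simpa using he
  exact h3.ne (h1.trans h2.symm)

theorem reach_sub_aux (T : SimpleGraph V) (hT : T.IsTree) (S : Set V)
    (hSconn : (T.induce S).Connected) (e : Sym2 ↥S) (a b : ↥S) :
    (T.deleteEdges {Sym2.map Subtype.val e}).Reachable (a : V) b ↔
      ((T.induce S).deleteEdges {e}).Reachable a b := by
  have hinj : Function.Injective (Subtype.val : ↥S → V) := Subtype.val_injective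
  obtain ⟨p, hp⟩ := (hSconn.preconnected a b).exists_isPath
  let φ : T.induce S →g T := (SimpleGraph.Embedding.induce S).toHom
  have hpm : (p.map φ).IsPath := SimpleGraph.Walk.map_isPath_of_injective hinj hp
  have hedge : Sym2.map Subtype.val e ∈ (p.map φ).edges ↔ e ∈ p.edges := by
    rw [SimpleGraph.Walk.edges_map]
    exact List.mem_map_of_injective (Sym2.map.injective hinj)
  by_cases hmem : e ∈ p.edges
  · have h1 : ¬ (T.deleteEdges {Sym2.map Subtype.val e}).Reachable (a : V) b := by
      rw [← coversIn_iff_aux]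
      have key : ∀ q : T.Walk (a : V) b, q.IsPath → Sym2.map Subtype.val e ∈ q.edges := by
        intro q hq
        have := hT.isAcyclic.path_unique ⟨q, hq⟩ ⟨p.map φ, hpm⟩
        have h := congrArg Subtype.val this
        simp only at h
        rw [h]
        exact hedge.2 hmem
      intro x y hxy q hq
      rcases Sym2.eq_iff.1 hxy with ⟨rfl, rfl⟩ | ⟨rfl, rfl⟩
      · exact key q hq
      · have := key q.reverse hq.reverse
        simpa using this
    refine ⟨fun h => absurd h h1, fun h => absurd ?_ h1⟩
    refine h.map ⟨Subtype.val, ?_⟩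
    intro x y hxy
    rw [SimpleGraph.deleteEdges_adj] at hxy ⊢
    refine ⟨by simpa using hxy.1, fun hc => hxy.2 ?_⟩
    exact Sym2.map.injective hinj hc
  · exact ⟨fun _ => ⟨p.toDeleteEdge _ hmem⟩,
      fun _ => ⟨(p.map φ).toDeleteEdge _ (fun h => hmem (hedge.1 h))⟩⟩

theorem covers_proj_aux (T : SimpleGraph V) (hT : T.IsTree) (S : Set V)
    (hSconn : (T.induce S).Connected) (π : V → ↥S)
    (hπpath : ∀ (x : V) (p : T.Walk x ↑(π x)), p.IsPath →
      ∀ y ∈ p.support, y ∈ S → y = ↑(π x))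
    (e : Sym2 ↥S) (he : e ∈ (T.induce S).edgeSet) (g : Sym2 V) :
    EdgeCoversIn T g (Sym2.map Subtype.val e) ↔
      EdgeCoversIn (T.induce S) (Sym2.map π g) e := by
  induction g with | _ u v
  rw [Sym2.map_mk, coversIn_iff_aux, coversIn_iff_aux, ← reach_sub_aux T hT S hSconn]
  have hu := reach_proj_aux T hT S π hπpath e he u
  have hv := reach_proj_aux T hT S π hπpath e he v
  exact not_congr ⟨fun h => (hu.symm.trans h).trans hv, fun h => (hu.trans h).trans hv.symm⟩

open scoped Classical in
theorem sum_proj_aux [Fintype V] (G : SimpleGraph V) (w : Sym2 V → ℝ)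
    (S : Set V) [Fintype ↥S] (π : V → ↥S) (G' : SimpleGraph ↥S)
    (hG' : ∀ a b : ↥S, G'.Adj a b ↔ a ≠ b ∧ ∃ g ∈ G.edgeSet, Sym2.map π g = s(a, b))
    (w' : Sym2 ↥S → ℝ)
    (hw' : ∀ a b : ↥S, a ≠ b →
      w' s(a, b) = ∑ g : Sym2 V, if g ∈ G.edgeSet ∧ Sym2.map π g = s(a, b) then w g else 0)
    (P : Sym2 V → Prop) (P' : Sym2 ↥S → Prop) (hP : ∀ g, P g ↔ P' (Sym2.map π g))
    (hd : ∀ g, P' g → ¬ g.IsDiag) :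
    (∑ g : Sym2 ↥S, if g ∈ G'.edgeSet ∧ P' g then w' g else 0)
      = ∑ g : Sym2 V, if g ∈ G.edgeSet ∧ P g then w g else 0 := by
  have h1 : ∀ g' : Sym2 ↥S, (if g' ∈ G'.edgeSet ∧ P' g' then w' g' else 0)
      = ∑ g : Sym2 V, if Sym2.map π g = g' then
          (if g ∈ G.edgeSet ∧ P g then w g else 0) else 0 := by
    intro g'
    by_cases hp : P' g'
    · have hnd := hd g' hp
      induction g' with | _ a b
      have hab : a ≠ b := hnd
      have h2 : (∑ g : Sym2 V, if Sym2.map π g = s(a, b) then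
          (if g ∈ G.edgeSet ∧ P g then w g else 0) else 0) = w' s(a, b) := by
        rw [hw' a b hab]
        refine Finset.sum_congr rfl fun g _ => ?_
        by_cases hg : Sym2.map π g = s(a, b)
        · simp [hP, hg, hp]
        · simp [hg]
      rw [h2]
      split_ifs with h
      · rfl
      · rw [hw' a b hab]
        symm
        refine Finset.sum_eq_zero fun g _ => if_neg fun hg => h ⟨?_, hp⟩
        exact (hG' a b).2 ⟨hab, g, hg⟩
    · rw [if_neg (fun h => hp h.2)]
      symm
      refine Finset.sum_eq_zero fun g _ => ?_
      split_ifs with h3 h4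
      · exact absurd (h3 ▸ (hP g).1 h4.2) hp
      · rfl
      · rfl
  rw [Finset.sum_congr rfl fun g' _ => h1 g', Finset.sum_comm]
  simp

open scoped Classical in
/-- Subtree projection preserves cover and cut values.  `S` induces a connected subtree
`T[S] = T.induce S` of the spanning tree `T`; `π x` is the unique vertex of `S` nearest to
`x` in `T` (characterized by: `π` fixes `S`, and the `T`-path from `x` to `π x` meets `S`
only in `π x`).  `G'` is the projected graph on `S` (an edge of `G` with `π u ≠ π v`
yields the edge `{π u, π v}`; edges with `π u = π v` are discarded), and `w'` sums the
weights of the parallel edges projecting to a given edge.  Then `T[S]` is a spanning tree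
of `G'` and all cover/cut values of tree edges of `T[S]` agree with those in `(G, T)`. -/
theorem stmt5 [Fintype V] (G T : SimpleGraph V) (w : Sym2 V → ℝ)
    (hw : ∀ g ∈ G.edgeSet, 0 < w g)
    (hle : T ≤ G) (hT : T.IsTree)
    (S : Set V) [Fintype ↥S]
    (hSconn : (T.induce S).Connected)
    (π : V → ↥S)
    (hπfix : ∀ (x : V) (hx : x ∈ S), π x = ⟨x, hx⟩)
    (hπpath : ∀ (x : V) (p : T.Walk x ↑(π x)), p.IsPath →
      ∀ y ∈ p.support, y ∈ S → y = ↑(π x))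
    (G' : SimpleGraph ↥S)
    (hG' : ∀ a b : ↥S, G'.Adj a b ↔ a ≠ b ∧ ∃ g ∈ G.edgeSet, Sym2.map π g = s(a, b))
    (w' : Sym2 ↥S → ℝ)
    (hw' : ∀ a b : ↥S, a ≠ b →
      w' s(a, b) = ∑ g : Sym2 V, if g ∈ G.edgeSet ∧ Sym2.map π g = s(a, b) then w g else 0) :
    T.induce S ≤ G' ∧ (T.induce S).IsTree ∧
    ∀ e f : Sym2 ↥S, e ∈ (T.induce S).edgeSet → f ∈ (T.induce S).edgeSet →
      covVal G' (T.induce S) w' e f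
          = covVal G T w (Sym2.map Subtype.val e) (Sym2.map Subtype.val f) ∧
      cutVal G' (T.induce S) w' e f
          = cutVal G T w (Sym2.map Subtype.val e) (Sym2.map Subtype.val f) ∧
      cutVal1 G' (T.induce S) w' e = cutVal1 G T w (Sym2.map Subtype.val e) := by
  have hcov := covers_proj_aux T hT S hSconn π hπpath
  have hsum := sum_proj_aux G w S π G' hG' w' hw'
  have hnd := covers_not_diag_aux (T.induce S)
  refine ⟨?_, ⟨hSconn, hT.isAcyclic.induce S⟩, ?_⟩
  · intro a b hab
    have h : T.Adj a b := by simpa using hab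
    refine (hG' a b).2 ⟨hab.ne, s(↑a, ↑b), hle h, ?_⟩
    rw [Sym2.map_mk, hπfix a a.2, hπfix b b.2]
  · intro e f he hf
    refine ⟨?_, ?_, ?_⟩
    · have := hsum (fun g => EdgeCoversIn T g (Sym2.map Subtype.val e) ∧
        EdgeCoversIn T g (Sym2.map Subtype.val f)) (fun g => EdgeCoversIn (T.induce S) g e ∧
        EdgeCoversIn (T.induce S) g f) (fun g => and_congr (hcov e he g) (hcov f hf g)) (fun g h => hnd g e h.1)
      unfold covVal
      convert this
    · refine hsum _ (fun g => Xor' (EdgeCoversIn (T.induce S) g e)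
        (EdgeCoversIn (T.induce S) g f)) (fun g => ?_) (fun g h => ?_)
      · rw [hcov e he g, hcov f hf g]
      · rcases h with h | h
        · exact hnd g e h.1
        · exact hnd g f h.1
    · exact hsum _ (fun g => EdgeCoversIn (T.induce S) g e) (fun g => hcov e he g) (fun g h => hnd g e h)
end

section
/- (Cut-equivalent subtrees.) Let T be a spanning tree of a finite weighted graph G and let c ∈ V(T). Let T_1, …, T_k be the connected components of T − c, and for each i let e_i = {c, u_i} be the unique tree edge joining c to T_i, where u_i ∈ V(T_i). For each i, define a weighted multigraph H_i with vertex set V(T_i) ∪ {c_i}, where c_i is a new vertex, as follows: every edge of G with both endpoints in V(T_i) is kept with its weight; for every edge g of G with exactly one endpoint u in V(T_i), an edge {u, c_i} of weight w(g) is added (parallel edges kept); edges of G with no endpoint in V(T_i) are discarded. Let T'_i be the tree consisting of T_i together with the edge e'_i := {u_i, c_i}. Then T'_i is a spanning tree of H_i and, identifying e_i with e'_i, for all e, f ∈ E(T_i) ∪ {e_i}: Cut_{T'_i, H_i}(e, f) = Cut_{T,G}(e, f) and Cut_{T'_i, H_i}(e) = Cut_{T,G}(e). -/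
open Finset

variable {V : Type*}

theorem covers_iff_aux (T : SimpleGraph V) (x y : V) (e : Sym2 V) :
    EdgeCoversIn T s(x, y) e ↔ ¬ (T.deleteEdges {e}).Reachable x y := by
  classical
  constructor
  · rintro h ⟨p⟩
    have h1 := h x y rfl ((p.toPath : (T.deleteEdges {e}).Walk x y).mapLe (T.deleteEdges_le {e}))
      (by
        rw [SimpleGraph.Walk.isPath_mapLe]
        exact p.toPath.2)
    have h2 : e ∈ (p.toPath : (T.deleteEdges {e}).Walk x y).edges := by
      simpa using h1
    have h3 := SimpleGraph.Walk.edges_subset_edgeSet _ h2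
    simp at h3
  · intro h a b hab p _
    by_contra hn
    have hr : (T.deleteEdges {e}).Reachable a b := ⟨p.toDeleteEdge e hn⟩
    rcases Sym2.eq_iff.mp hab with ⟨rfl, rfl⟩ | ⟨rfl, rfl⟩
    · exact h hr
    · exact h hr.symm

theorem reach_aux {W : Type*} (A : SimpleGraph V) (B : SimpleGraph W) (φ : V → W)
    (h : ∀ x y, A.Adj x y → φ x = φ y ∨ B.Adj (φ x) (φ y)) {x y : V}
    (hr : A.Reachable x y) : B.Reachable (φ x) (φ y) := by
  obtain ⟨p⟩ := hr
  induction p with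
  | nil => exact SimpleGraph.Reachable.refl _
  | cons hadj _ ih =>
    rcases h _ _ hadj with h1 | h1
    · rw [h1]; exact ih
    · exact h1.reachable.trans ih

open scoped Classical in
noncomputable def ctr (S : Set V) (x : V) : Option ↥S := if h : x ∈ S then some ⟨x, h⟩ else none

theorem ctr_mem {S : Set V} {x : V} (h : x ∈ S) : ctr S x = some ⟨x, h⟩ := by
  simp [ctr, h]

theorem ctr_not {S : Set V} {x : V} (h : x ∉ S) : ctr S x = none := by
  simp [ctr, h]

theorem ctr_some {S : Set V} {x : V} {a : ↥S} : ctr S x = some a ↔ x = a := by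
  unfold ctr
  split_ifs with h
  · simp [Subtype.ext_iff]
  · simp only [reduceCtorEq, false_iff]
    rintro rfl
    exact h a.2

theorem ctr_none {S : Set V} {x : V} : ctr S x = none ↔ x ∉ S := by
  unfold ctr
  split_ifs with h <;> simp [h]

open scoped Classical in
theorem sum_aux [Fintype V] (G : SimpleGraph V) (w : Sym2 V → ℝ)
    (S : Set V) [Fintype ↥S]
    (H : SimpleGraph (Option ↥S))
    (hH1 : ∀ a b : ↥S, H.Adj (some a) (some b) ↔ G.Adj ↑a ↑b)
    (hH2 : ∀ a : ↥S, H.Adj (some a) none ↔ ∃ y : V, y ∉ S ∧ G.Adj ↑a y)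
    (w' : Sym2 (Option ↥S) → ℝ)
    (hw'1 : ∀ a b : ↥S, w' s(some a, some b) = w s((↑a : V), (↑b : V)))
    (hw'2 : ∀ a : ↥S, w' s(some a, none) =
      ∑ y : V, if y ∉ S ∧ G.Adj ↑a y then w s((↑a : V), y) else 0)
    (P : Sym2 (Option ↥S) → Prop) (Q : Sym2 V → Prop)
    (hP : ¬ P s(none, none))
    (hPQ : ∀ g, Q g ↔ P (Sym2.map (ctr S) g)) :
    (∑ g, if g ∈ H.edgeSet ∧ P g then w' g else 0) =
      ∑ g, if g ∈ G.edgeSet ∧ Q g then w g else 0 := by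
  rw [← Finset.sum_fiberwise (s := Finset.univ) (g := Sym2.map (ctr S))
    (f := fun g => if g ∈ G.edgeSet ∧ Q g then w g else 0)]
  refine Finset.sum_congr rfl fun g' _ => ?_
  have hsn : ∀ a : ↥S, (if s(some a, none) ∈ H.edgeSet ∧ P s(some a, none)
      then w' s(some a, none) else 0) =
      ∑ g with Sym2.map (ctr S) g = s(some a, none),
        if g ∈ G.edgeSet ∧ Q g then w g else 0 := by
    intro a
    have hfib : (Finset.univ.filter fun g => Sym2.map (ctr S) g = s(some a, none)) =
        (Finset.univ.filter fun y : V => y ∉ S).image fun y => s((a : V), y) := by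
      ext g
      induction g using Sym2.ind with
      | _ x y =>
        simp only [Finset.mem_filter, Finset.mem_univ, true_and, Finset.mem_image,
          Sym2.map_mk, Sym2.eq_iff, ctr_some, ctr_none]
        constructor
        · rintro (⟨rfl, h⟩ | ⟨h, rfl⟩)
          · exact ⟨y, h, Or.inl ⟨rfl, rfl⟩⟩
          · exact ⟨x, h, Or.inr ⟨rfl, rfl⟩⟩
        · rintro ⟨z, hz, ⟨rfl, rfl⟩ | ⟨rfl, rfl⟩⟩
          · exact Or.inl ⟨rfl, hz⟩
          · exact Or.inr ⟨hz, rfl⟩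
    rw [hfib, Finset.sum_image (by
      intro y _ z _ h
      exact Sym2.congr_right.1 h), Finset.sum_filter, hw'2]
    by_cases hPa : P s(some a, none)
    · have hc : ∀ y : V, (if y ∉ S then (if s((a : V), y) ∈ G.edgeSet ∧ Q s((a : V), y)
          then w s((a : V), y) else 0) else 0) =
          if y ∉ S ∧ G.Adj ↑a y then w s((↑a : V), y) else 0 := by
        intro y
        by_cases hy : y ∈ S
        · simp [hy]
        · have : Q s((a : V), y) := by
            rw [hPQ, Sym2.map_mk, ctr_not hy, ctr_some.2 rfl]
            exact hPa
          simp [hy, this]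
      rw [Finset.sum_congr rfl fun y _ => hc y]
      by_cases hadj : H.Adj (some a) none
      · simp [hadj, hPa]
      · have hno : ∀ y, ¬ (y ∉ S ∧ G.Adj ↑a y) := fun y hy => hadj ((hH2 a).2 ⟨y, hy⟩)
        simp only [hno, if_false, Finset.sum_const_zero, ite_self]
    · rw [if_neg (fun h => hPa h.2)]
      symm
      refine Finset.sum_eq_zero fun y _ => ?_
      by_cases hy : y ∈ S
      · simp [hy]
      · have : ¬ Q s((a : V), y) := by
          rw [hPQ, Sym2.map_mk, ctr_not hy, ctr_some.2 rfl]
          exact hPa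
        simp [this]
  induction g' using Sym2.ind with
  | _ o1 o2 =>
    rcases o1 with _ | a <;> rcases o2 with _ | b
    · rw [if_neg (fun h => hP h.2)]
      symm
      refine Finset.sum_eq_zero fun g hg => ?_
      rw [if_neg]
      rintro ⟨-, hq⟩
      rw [hPQ, (Finset.mem_filter.1 hg).2] at hq
      exact hP hq
    · rw [Sym2.eq_swap]; exact hsn b
    · exact hsn a
    · have hfib : (Finset.univ.filter fun g => Sym2.map (ctr S) g = s(some a, some b)) =
          {s((a : V), (b : V))} := by
        ext g
        induction g using Sym2.ind with
        | _ x y =>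
          simp only [Finset.mem_filter, Finset.mem_univ, true_and, Finset.mem_singleton,
            Sym2.map_mk, Sym2.eq_iff, ctr_some]
      rw [hfib, Finset.sum_singleton, hw'1, hPQ, Sym2.map_mk, ctr_some.2 rfl, ctr_some.2 rfl]
      simp only [SimpleGraph.mem_edgeSet, hH1]

open scoped Classical in
/-- Cut-equivalent subtrees.  `c` is a vertex of the spanning tree `T` of `G`, `u` is a
`T`-neighbour of `c`, and `S` is the vertex set of the connected component of `T - c`
containing `u` (`x ∈ S` iff `x ≠ c` and the `T`-path from `x` to `c` passes through `u`).
`H` is the graph on `Option ↥S` where `none` plays the role of the new virtual vertex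
`c_i`: edges of `G` inside `S` are kept, an edge of `G` with exactly one endpoint `a ∈ S`
is redirected to `{a, c_i}` (parallel edges summed in `w'`), and the remaining edges are
discarded.  `T'` is `T_i` together with the edge `{u, c_i}`.  Then `T'` is a spanning tree
of `H`, and — identifying `none` with `c` via the map `o ↦ o.elim c ↑·` (so the edge
`{u, c_i}` is identified with `e_i = {u, c}`) — all 2-respecting and 1-respecting cut
values of tree edges of `T'` agree with those in `(G, T)`. -/
theorem stmt6 [Fintype V] (G T : SimpleGraph V) (w : Sym2 V → ℝ)
    (hw : ∀ g ∈ G.edgeSet, 0 < w g)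
    (hle : T ≤ G) (hT : T.IsTree)
    (c u : V) (hcu : T.Adj c u)
    (S : Set V) [Fintype ↥S]
    (hS : ∀ x : V, x ∈ S ↔ x ≠ c ∧ ∀ p : T.Walk x c, p.IsPath → u ∈ p.support)
    (H : SimpleGraph (Option ↥S))
    (hH1 : ∀ a b : ↥S, H.Adj (some a) (some b) ↔ G.Adj ↑a ↑b)
    (hH2 : ∀ a : ↥S, H.Adj (some a) none ↔ ∃ y : V, y ∉ S ∧ G.Adj ↑a y)
    (T' : SimpleGraph (Option ↥S))
    (hT'1 : ∀ a b : ↥S, T'.Adj (some a) (some b) ↔ T.Adj ↑a ↑b)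
    (hT'2 : ∀ a : ↥S, T'.Adj (some a) none ↔ (↑a : V) = u)
    (w' : Sym2 (Option ↥S) → ℝ)
    (hw'1 : ∀ a b : ↥S, w' s(some a, some b) = w s((↑a : V), (↑b : V)))
    (hw'2 : ∀ a : ↥S, w' s(some a, none) =
      ∑ y : V, if y ∉ S ∧ G.Adj ↑a y then w s((↑a : V), y) else 0) :
    T' ≤ H ∧ T'.IsTree ∧
    ∀ e f : Sym2 (Option ↥S), e ∈ T'.edgeSet → f ∈ T'.edgeSet →
      cutVal H T' w' e f
          = cutVal G T w (Sym2.map (fun o => o.elim c Subtype.val) e)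
              (Sym2.map (fun o => o.elim c Subtype.val) f) ∧
      cutVal1 H T' w' e = cutVal1 G T w (Sym2.map (fun o => o.elim c Subtype.val) e) := by
  classical
  have hcS : c ∉ S := fun h => ((hS c).1 h).1 rfl
  have huS : u ∈ S := (hS u).2 ⟨hcu.ne', fun p _ => p.start_mem_support⟩
  -- vertices on a `u`-avoiding path to `c` are outside `S`
  have hout : ∀ x (p : T.Walk x c), p.IsPath → u ∉ p.support → ∀ v ∈ p.support, v ∉ S := by
    intro x p hp hu v hv hvS
    exact hu (p.support_dropUntil_subset hv (((hS v).1 hvS).2 (p.dropUntil v hv) (hp.dropUntil hv)))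
  have hpath : ∀ x, x ∉ S → ∃ p : T.Walk x c, p.IsPath ∧ ∀ v ∈ p.support, v ∉ S := by
    intro x hx
    by_cases hxc : x = c
    · subst hxc
      exact ⟨.nil, by simp, by simpa using hx⟩
    · rw [hS] at hx
      push Not at hx
      obtain ⟨p, hp, hu⟩ := hx hxc
      exact ⟨p, hp, hout x p hp hu⟩
  have hbd : ∀ x y, T.Adj x y → x ∈ S → y ∉ S → x = u ∧ y = c := by
    intro x y hxy hx hy
    obtain ⟨p, hp, hpS⟩ := hpath y hy
    have hxp : x ∉ p.support := fun h => hpS x h hx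
    have hq : (SimpleGraph.Walk.cons hxy p).IsPath := hp.cons hxp
    have hu := ((hS x).1 hx).2 _ hq
    rw [SimpleGraph.Walk.support_cons, List.mem_cons] at hu
    rcases hu with rfl | hu
    · refine ⟨rfl, ?_⟩
      have hs : (SimpleGraph.Walk.cons hcu.symm SimpleGraph.Walk.nil).IsPath := by
        simp [hcu.ne']
      have := hT.isAcyclic.path_unique ⟨_, hq⟩ ⟨_, hs⟩
      have h2 := congrArg (fun q : T.Path u c => q.1.length) this
      simp at h2
      exact h2.eq
    · exact absurd huS (hpS u hu)
  set ι : Option ↥S → V := fun o => o.elim c Subtype.val with hι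
  have hιinj : Function.Injective ι := by
    rintro (_ | a) (_ | b) h
    · rfl
    · exact absurd (show c = b from h) (fun h => hcS (h ▸ b.2))
    · exact absurd (show (a : V) = c from h) (fun h => hcS (h ▸ a.2))
    · exact congrArg some (Subtype.ext h)
  have hιadj : ∀ o1 o2, T'.Adj o1 o2 → T.Adj (ι o1) (ι o2) := by
    rintro (_ | a) (_ | b) h
    · exact absurd h (T'.loopless.irrefl _)
    · have := (hT'2 b).1 h.symm
      change T.Adj c b
      rw [this]; exact hcu
    · have := (hT'2 a).1 h
      change T.Adj a c
      rw [this]; exact hcu.symm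
    · exact (hT'1 a b).1 h
  have hφadj : ∀ x y, T.Adj x y → ctr S x = ctr S y ∨
      (T'.Adj (ctr S x) (ctr S y) ∧ ι (ctr S x) = x ∧ ι (ctr S y) = y) := by
    intro x y h
    by_cases hx : x ∈ S <;> by_cases hy : y ∈ S
    · rw [ctr_mem hx, ctr_mem hy]
      exact Or.inr ⟨(hT'1 _ _).2 h, rfl, rfl⟩
    · obtain ⟨rfl, rfl⟩ := hbd x y h hx hy
      rw [ctr_mem hx, ctr_not hy]
      exact Or.inr ⟨(hT'2 _).2 rfl, rfl, rfl⟩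
    · obtain ⟨rfl, rfl⟩ := hbd y x h.symm hy hx
      rw [ctr_mem hy, ctr_not hx]
      exact Or.inr ⟨((hT'2 _).2 rfl).symm, rfl, rfl⟩
    · left; rw [ctr_not hx, ctr_not hy]
  have hφι : ∀ o, ctr S (ι o) = o := by
    rintro (_ | a)
    · exact ctr_not hcS
    · exact ctr_some.2 rfl
  have hcov : ∀ e ∈ T'.edgeSet, ∀ g, EdgeCoversIn T g (Sym2.map ι e) ↔
      EdgeCoversIn T' (Sym2.map (ctr S) g) e := by
    intro e he g
    induction g using Sym2.ind with
    | _ x y =>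
    rw [Sym2.map_mk, covers_iff_aux, covers_iff_aux, not_iff_not]
    constructor
    · apply reach_aux
      intro a b hab
      rw [SimpleGraph.deleteEdges_adj] at hab ⊢
      rcases hφadj a b hab.1 with h | ⟨h, ha, hb⟩
      · exact Or.inl h
      · refine Or.inr ⟨h, fun hh => hab.2 ?_⟩
        rw [Set.mem_singleton_iff] at hh ⊢
        rw [← hh, Sym2.map_mk, ha, hb]
    · have hback : ∀ x, (T.deleteEdges {Sym2.map ι e}).Reachable x (ι (ctr S x)) := by
        intro x
        by_cases hx : x ∈ S
        · rw [ctr_mem hx]; exact SimpleGraph.Reachable.refl _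
        · rw [ctr_not hx]
          obtain ⟨p, hp, hpS⟩ := hpath x hx
          refine ⟨p.toDeleteEdge _ fun hmem => ?_⟩
          have key : ∃ a : ↥S, some a ∈ e := by
            induction e using Sym2.ind with
            | _ o1 o2 =>
            rcases o1 with _ | a
            · rcases o2 with _ | b
              · exact absurd he (T'.loopless.irrefl _)
              · exact ⟨b, by simp⟩
            · exact ⟨a, by simp⟩
          obtain ⟨a, ha⟩ := key
          exact hpS a (SimpleGraph.Walk.mem_support_of_mem_edges hmem
            (Sym2.mem_map.2 ⟨some a, ha, rfl⟩)) a.2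
      intro h
      refine (hback x).trans (SimpleGraph.Reachable.trans ?_ (hback y).symm)
      refine reach_aux _ _ ι ?_ h
      intro a b hab
      rw [SimpleGraph.deleteEdges_adj] at hab ⊢
      refine Or.inr ⟨hιadj _ _ hab.1, fun hh => hab.2 ?_⟩
      rw [Set.mem_singleton_iff] at hh ⊢
      rw [← Sym2.map_mk] at hh
      exact Sym2.map.injective hιinj hh
  have hnn : ∀ e, ¬ EdgeCoversIn T' s(none, none) e := by
    intro e
    rw [covers_iff_aux, not_not]
  refine ⟨?_, ⟨?_, ?_⟩, ?_⟩
  · rintro (_ | a) (_ | b) h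
    · exact absurd h (T'.loopless.irrefl _)
    · exact ((hH2 b).2 ⟨c, hcS, hle (hιadj _ _ h.symm)⟩).symm
    · exact (hH2 a).2 ⟨c, hcS, hle (hιadj _ _ h)⟩
    · exact (hH1 a b).2 (hle (hιadj _ _ h))
  · haveI : Nonempty (Option ↥S) := ⟨none⟩
    refine SimpleGraph.Connected.mk fun a b => ?_
    rw [← hφι a, ← hφι b]
    refine reach_aux T T' (ctr S) (fun x y h => ?_) (hT.connected.preconnected _ _)
    exact (hφadj x y h).imp id fun h => h.1
  · exact hT.isAcyclic.comap ⟨ι, fun h => hιadj _ _ h⟩ hιinj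
  · intro e f he hf
    refine ⟨?_, ?_⟩
    · unfold cutVal
      refine sum_aux G w S H hH1 hH2 w' hw'1 hw'2
        (fun g => Xor' (EdgeCoversIn T' g e) (EdgeCoversIn T' g f)) _ ?_ ?_
      · rintro (h | h)
        · exact hnn _ h.1
        · exact hnn _ h.1
      · intro g
        rw [hcov e he, hcov f hf]
    · unfold cutVal1
      exact sum_aux G w S H hH1 hH2 w' hw'1 hw'2
        (fun g => EdgeCoversIn T' g e) _ (hnn e) (hcov e he)
end

section
/- Let (G, T) be a star instance with paths P_1, …, P_k, and let e ∈ E(P_i) and f ∈ E(P_j) be tree edges on two different paths (i ≠ j). If Cut_{T,G}(e, f) < Cut_{T,G}(g) for every tree edge g ∈ E(T) (i.e., Cut(e,f) is smaller than every 1-respecting cut value), then CrossCov(e, f) > CrossCov(e) / 2. -/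
open Finset

variable {V : Type*}

/-- The `t`-th edge (in order of increasing depth, `t = 0` being the attachment edge at
the root) of the `i`-th descending path of a star instance whose `i`-th path has vertex
chain `v i 0 = r, v i 1, …, v i (ℓ i)`. -/
def PathEdge {k : ℕ} (ℓ : Fin k → ℕ) (v : (i : Fin k) → Fin (ℓ i + 1) → V)
    (i : Fin k) (t : Fin (ℓ i)) : Sym2 V :=
  s(v i t.castSucc, v i t.succ)

/-- `g` is a cross-edge of the star instance: its two endpoints lie on two different
paths (the root `r = v i 0` does not lie on any path). -/
def IsCrossEdge {k : ℕ} (ℓ : Fin k → ℕ) (v : (i : Fin k) → Fin (ℓ i + 1) → V)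
    (g : Sym2 V) : Prop :=
  ∃ (i j : Fin k) (x : Fin (ℓ i + 1)) (y : Fin (ℓ j + 1)),
    i ≠ j ∧ (x : ℕ) ≠ 0 ∧ (y : ℕ) ≠ 0 ∧ g = s(v i x, v j y)

open scoped Classical in
/-- `CrossCov(e, f)`: total weight of the cross-edges covering both `e` and `f`. -/
noncomputable def crossCov2 [Fintype V] (G T : SimpleGraph V) (w : Sym2 V → ℝ)
    {k : ℕ} (ℓ : Fin k → ℕ) (v : (i : Fin k) → Fin (ℓ i + 1) → V)
    (e f : Sym2 V) : ℝ :=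
  ∑ g : Sym2 V,
    if g ∈ G.edgeSet ∧ IsCrossEdge ℓ v g ∧ EdgeCoversIn T g e ∧ EdgeCoversIn T g f
    then w g else 0

open scoped Classical in
/-- `CrossCov(e)`: total weight of the cross-edges covering `e`. -/
noncomputable def crossCov1 [Fintype V] (G T : SimpleGraph V) (w : Sym2 V → ℝ)
    {k : ℕ} (ℓ : Fin k → ℕ) (v : (i : Fin k) → Fin (ℓ i + 1) → V)
    (e : Sym2 V) : ℝ :=
  ∑ g : Sym2 V,
    if g ∈ G.edgeSet ∧ IsCrossEdge ℓ v g ∧ EdgeCoversIn T g e then w g else 0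


theorem star_walk (T : SimpleGraph V) {k : ℕ} (ℓ : Fin k → ℕ)
    (v : (i : Fin k) → Fin (ℓ i + 1) → V)
    (hAdj : ∀ x y : V, T.Adj x y ↔
      ∃ (i : Fin k) (t : Fin (ℓ i)), s(x, y) = PathEdge ℓ v i t)
    (a : Fin k) (x : Fin (ℓ a + 1)) :
    ∃ p : T.Walk (v a 0) (v a x), ∀ e ∈ p.edges, ∃ t, e = PathEdge ℓ v a t := by
  induction x using Fin.induction with
  | zero => exact ⟨SimpleGraph.Walk.nil, by simp⟩
  | succ t ih =>
    obtain ⟨p, hp⟩ := ih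
    have h : T.Adj (v a t.castSucc) (v a t.succ) := (hAdj _ _).2 ⟨a, t, rfl⟩
    refine ⟨p.concat h, ?_⟩
    intro e he
    rw [SimpleGraph.Walk.edges_concat, List.concat_eq_append, List.mem_append] at he
    rcases he with he | he
    · exact hp e he
    · exact ⟨t, by simpa [PathEdge] using he⟩

theorem star_edge_index {k : ℕ} (r : V) (ℓ : Fin k → ℕ)
    (v : (i : Fin k) → Fin (ℓ i + 1) → V)
    (hvinj : ∀ i, Function.Injective (v i))
    (hdisj : ∀ i j x y, i ≠ j → v i x = v j y → v i x = r)
    (a b : Fin k) (s : Fin (ℓ a)) (t : Fin (ℓ b))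
    (h : PathEdge ℓ v a s = PathEdge ℓ v b t) : a = b := by
  by_contra hab
  have key : v a s.castSucc = r ∧ v a s.succ = r := by
    unfold PathEdge at h
    rcases Sym2.eq_iff.1 h with ⟨h1, h2⟩ | ⟨h1, h2⟩
    · exact ⟨hdisj _ _ _ _ hab h1, hdisj _ _ _ _ hab h2⟩
    · exact ⟨hdisj _ _ _ _ hab h1, hdisj _ _ _ _ hab h2⟩
  have := hvinj a (key.1.trans key.2.symm)
  have := congrArg Fin.val this
  simp at this

theorem star_cross (T : SimpleGraph V) (hT : T.IsTree)
    (r : V) (k : ℕ) (ℓ : Fin k → ℕ) (v : (i : Fin k) → Fin (ℓ i + 1) → V)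
    (hv0 : ∀ i, v i 0 = r)
    (hvinj : ∀ i, Function.Injective (v i))
    (hdisj : ∀ i j x y, i ≠ j → v i x = v j y → v i x = r)
    (hAdj : ∀ x y : V, T.Adj x y ↔
      ∃ (i : Fin k) (t : Fin (ℓ i)), s(x, y) = PathEdge ℓ v i t)
    (i j : Fin k) (hij : i ≠ j) (tP : Fin (ℓ i)) (tQ : Fin (ℓ j))
    (g : Sym2 V) (he : EdgeCoversIn T g (PathEdge ℓ v i tP))
    (hf : EdgeCoversIn T g (PathEdge ℓ v j tQ)) : IsCrossEdge ℓ v g := by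
  classical
  have same : ∀ (a : Fin k) (x y : Fin (ℓ a + 1)), g ≠ s(v a x, v a y) := by
    intro a x y hg
    obtain ⟨p, hp⟩ := star_walk T ℓ v hAdj a x
    obtain ⟨q, hq⟩ := star_walk T ℓ v hAdj a y
    have hall : ∀ e ∈ (p.reverse.append q).bypass.edges, ∃ t, e = PathEdge ℓ v a t := by
      intro e h
      have h := SimpleGraph.Walk.edges_bypass_subset_edges _ h
      rw [SimpleGraph.Walk.edges_append, List.mem_append, SimpleGraph.Walk.edges_reverse,
        List.mem_reverse] at h
      exact h.elim (hp e) (hq e)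
    have hpath := (p.reverse.append q).bypass_isPath
    obtain ⟨t, ht⟩ := hall _ (he _ _ hg _ hpath)
    obtain ⟨t', ht'⟩ := hall _ (hf _ _ hg _ hpath)
    exact hij ((star_edge_index r ℓ v hvinj hdisj _ _ _ _ ht).trans
      (star_edge_index r ℓ v hvinj hdisj _ _ _ _ ht').symm)
  have cov : ∀ u : V, ∃ (a : Fin k) (x : Fin (ℓ a + 1)), u = v a x := by
    intro u
    by_cases hu : u = r
    · exact ⟨i, 0, by rw [hv0, hu]⟩
    · obtain ⟨p⟩ := hT.1.preconnected u r
      cases p with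
      | nil => exact absurd rfl hu
      | cons h _ =>
        obtain ⟨a, t, h⟩ := (hAdj _ _).1 h
        unfold PathEdge at h
        rcases Sym2.eq_iff.1 h with ⟨h1, h2⟩ | ⟨h1, h2⟩
        · exact ⟨a, _, h1⟩
        · exact ⟨a, _, h1⟩
  induction g using Sym2.ind with
  | _ u u' =>
    obtain ⟨a, x, rfl⟩ := cov u
    obtain ⟨b, y, rfl⟩ := cov u'
    refine ⟨a, b, x, y, ?_, ?_, ?_, rfl⟩
    · rintro rfl
      exact same _ _ _ rfl
    · intro hx
      obtain rfl : x = 0 := Fin.ext hx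
      exact same b 0 y (by rw [hv0 a, hv0 b])
    · intro hx
      obtain rfl : y = 0 := Fin.ext hx
      exact same a x 0 (by rw [hv0 a, hv0 b])

/-- In a star instance, if the 2-respecting cut value of a pair of tree edges on two
different paths is smaller than every 1-respecting cut value, then more than half the
(weighted) cross-edges covering the first edge also cover the second one. -/
theorem stmt8 [Fintype V] (G T : SimpleGraph V) (w : Sym2 V → ℝ)
    (hw : ∀ g ∈ G.edgeSet, 0 < w g)
    (hle : T ≤ G) (hT : T.IsTree)
    (r : V) (k : ℕ) (ℓ : Fin k → ℕ) (v : (i : Fin k) → Fin (ℓ i + 1) → V)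
    (hv0 : ∀ i, v i 0 = r)
    (hvinj : ∀ i, Function.Injective (v i))
    (hdisj : ∀ i j x y, i ≠ j → v i x = v j y → v i x = r)
    (hAdj : ∀ x y : V, T.Adj x y ↔
      ∃ (i : Fin k) (t : Fin (ℓ i)), s(x, y) = PathEdge ℓ v i t)
    (i j : Fin k) (hij : i ≠ j) (tP : Fin (ℓ i)) (tQ : Fin (ℓ j))
    (hsmall : ∀ g ∈ T.edgeSet,
      cutVal G T w (PathEdge ℓ v i tP) (PathEdge ℓ v j tQ) < cutVal1 G T w g) :
    crossCov2 G T w ℓ v (PathEdge ℓ v i tP) (PathEdge ℓ v j tQ) >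
      crossCov1 G T w ℓ v (PathEdge ℓ v i tP) / 2 := by
  have hf := hsmall (PathEdge ℓ v j tQ) ((hAdj _ _).2 ⟨j, tQ, rfl⟩)
  have key : crossCov1 G T w ℓ v (PathEdge ℓ v i tP) +
      cutVal1 G T w (PathEdge ℓ v j tQ) ≤
      cutVal G T w (PathEdge ℓ v i tP) (PathEdge ℓ v j tQ) +
      2 * crossCov2 G T w ℓ v (PathEdge ℓ v i tP) (PathEdge ℓ v j tQ) := by
    unfold crossCov1 cutVal1 cutVal crossCov2
    rw [Finset.mul_sum, ← Finset.sum_add_distrib, ← Finset.sum_add_distrib]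
    refine Finset.sum_le_sum fun g _ => ?_
    have hc := star_cross T hT r k ℓ v hv0 hvinj hdisj hAdj i j hij tP tQ g
    by_cases hg : g ∈ G.edgeSet
    · have := hw g hg
      by_cases h1 : EdgeCoversIn T g (PathEdge ℓ v i tP) <;>
      by_cases h2 : EdgeCoversIn T g (PathEdge ℓ v j tQ) <;>
      by_cases h3 : IsCrossEdge ℓ v g <;>
      first
        | exact absurd (hc h1 h2) h3
        | (simp only [hg, h1, h2, h3, Xor', Xor, true_and, and_true, and_false, false_and, not_true,
            not_false_iff, if_true, if_false, or_false, false_or, and_self, or_self]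
           linarith)
    · simp [hg]
  linarith
end

section
/- Let (G, T) be a star instance with paths P_1, …, P_k. Let e_1, e_2 ∈ E(P_i) be two edges on the same path with e_1 closer to the root (e_1 lies on the T-path from the root to e_2), and let f ∈ E(P_j) with j ≠ i. If CrossCov(e_2, f) ≤ (1/10)·CrossCov(e_2) and CrossCov(e_1, f) > (1/5)·CrossCov(e_1), then CrossCov(e_1) ≥ (11/10)·CrossCov(e_2). -/
open Finset

variable {V : Type*}

section helpers

variable {T : SimpleGraph V} {r : V} {k : ℕ} {ℓ : Fin k → ℕ}
  {v : (i : Fin k) → Fin (ℓ i + 1) → V}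

lemma root_aux (hv0 : ∀ i, v i 0 = r) (hvinj : ∀ i, Function.Injective (v i))
    (a : Fin k) (x : Fin (ℓ a + 1)) (h : v a x = r) : (x : ℕ) = 0 := by
  have : x = 0 := hvinj a (h.trans (hv0 a).symm)
  simp [this]

lemma walk_aux (hv0 : ∀ i, v i 0 = r) (hvinj : ∀ i, Function.Injective (v i))
    (hdisj : ∀ i j x y, i ≠ j → v i x = v j y → v i x = r)
    (hAdj : ∀ x y : V, T.Adj x y ↔
      ∃ (i : Fin k) (t : Fin (ℓ i)), s(x, y) = PathEdge ℓ v i t)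
    (i : Fin k) (t : Fin (ℓ i)) (a : Fin k) (n : ℕ) (h : n < ℓ a + 1)
    (hn : a = i → n ≤ (t : ℕ)) :
    ∃ p : T.Walk (v a ⟨n, h⟩) r, PathEdge ℓ v i t ∉ p.edges := by
  induction n with
  | zero =>
    have : v a ⟨0, h⟩ = r := hv0 a
    rw [this]
    exact ⟨SimpleGraph.Walk.nil, by simp⟩
  | succ n ih =>
    obtain ⟨p, hp⟩ := ih (by omega) (fun e => by have := hn e; omega)
    have hadj : T.Adj (v a ⟨n + 1, h⟩) (v a ⟨n, by omega⟩) := by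
      rw [hAdj]
      exact ⟨a, ⟨n, by omega⟩, by rw [Sym2.eq_swap]; rfl⟩
    refine ⟨SimpleGraph.Walk.cons hadj p, ?_⟩
    rw [SimpleGraph.Walk.edges_cons, List.mem_cons, not_or]
    refine ⟨?_, hp⟩
    intro heq
    have hmem : v a ⟨n + 1, h⟩ ∈ PathEdge ℓ v i t := by rw [heq]; simp
    have key : ∃ s : Fin (ℓ i + 1), v a ⟨n + 1, h⟩ = v i s := by
      simp only [PathEdge, Sym2.mem_iff] at hmem
      rcases hmem with h | h <;> exact ⟨_, h⟩
    by_cases hai : a = i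
    · subst hai
      have hn' := hn rfl
      have hmem2 : v a t.succ ∈ s(v a ⟨n + 1, h⟩, v a ⟨n, by omega⟩) := by
        rw [← heq]; simp [PathEdge]
      rw [Sym2.mem_iff] at hmem2
      rcases hmem2 with h | h <;> have := congrArg Fin.val (hvinj a h) <;>
        simp at this <;> omega
    · obtain ⟨s, hs⟩ := key
      have := root_aux hv0 hvinj _ _ (hdisj _ _ _ _ hai hs)
      simp at this

lemma cross_aux (hv0 : ∀ i, v i 0 = r) (hvinj : ∀ i, Function.Injective (v i))
    (hdisj : ∀ i j x y, i ≠ j → v i x = v j y → v i x = r)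
    (hAdj : ∀ x y : V, T.Adj x y ↔
      ∃ (i : Fin k) (t : Fin (ℓ i)), s(x, y) = PathEdge ℓ v i t)
    (i : Fin k) (t : Fin (ℓ i)) {a b : V} (p : T.Walk a b)
    (ha : ∃ s : Fin (ℓ i + 1), (t : ℕ) < s ∧ a = v i s)
    (hb : ¬ ∃ s : Fin (ℓ i + 1), (t : ℕ) < s ∧ b = v i s) :
    PathEdge ℓ v i t ∈ p.edges := by
  obtain ⟨d, hd, ⟨s, hs, h1⟩, h2⟩ := p.exists_boundary_dart
    {x | ∃ s : Fin (ℓ i + 1), (t : ℕ) < s ∧ x = v i s} ha hb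
  have hde : d.edge ∈ p.edges := List.mem_map_of_mem hd
  suffices d.edge = PathEdge ℓ v i t by rwa [← this]
  obtain ⟨c, u, hcu⟩ := (hAdj _ _).1 d.adj
  have hed : d.edge = PathEdge ℓ v c u := hcu
  simp only [Set.mem_setOf_eq, not_exists, not_and] at h2
  by_cases hci : c = i
  · subst hci
    rw [hed]
    suffices u = t by rw [this]
    simp only [PathEdge, Sym2.eq_iff] at hcu
    rcases hcu with ⟨e1, e2⟩ | ⟨e1, e2⟩
    · have h3 := congrArg Fin.val (hvinj c (h1.symm.trans e1))
      have h4 := h2 u.succ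
      simp at h3 h4
      exact absurd e2 (h4 (by omega))
    · have h3 := congrArg Fin.val (hvinj c (h1.symm.trans e1))
      have h4 := fun h => h2 u.castSucc h e2
      simp at h3 h4
      apply Fin.ext
      have : (u : ℕ) ≤ t := h4
      omega
  · exfalso
    have hm : d.fst ∈ PathEdge ℓ v c u := by rw [← hcu]; simp
    have : ∃ x, v i s = v c x := by
      simp only [PathEdge, Sym2.mem_iff] at hm
      rcases hm with h | h <;> exact ⟨_, h1.symm.trans h⟩
    obtain ⟨x, hx⟩ := this
    have := root_aux hv0 hvinj _ _ (hdisj _ _ _ _ (Ne.symm hci) hx)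
    omega

lemma covers_mono (hv0 : ∀ i, v i 0 = r) (hvinj : ∀ i, Function.Injective (v i))
    (hdisj : ∀ i j x y, i ≠ j → v i x = v j y → v i x = r)
    (hAdj : ∀ x y : V, T.Adj x y ↔
      ∃ (i : Fin k) (t : Fin (ℓ i)), s(x, y) = PathEdge ℓ v i t)
    (i : Fin k) (t1 t2 : Fin (ℓ i)) (h12 : t1 ≤ t2) (g : Sym2 V)
    (hg : IsCrossEdge ℓ v g) (hc : EdgeCoversIn T g (PathEdge ℓ v i t2)) :
    EdgeCoversIn T g (PathEdge ℓ v i t1) := by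
  classical
  have h12' : (t1 : ℕ) ≤ t2 := h12
  obtain ⟨a, b, x, y, hab, hx, hy, rfl⟩ := hg
  -- below `t1` membership forces path index `i`
  have hidx : ∀ (c : Fin k) (z : Fin (ℓ c + 1)), c ≠ i → (z : ℕ) ≠ 0 →
      ¬ ∃ s : Fin (ℓ i + 1), (t1 : ℕ) < s ∧ v c z = v i s := by
    rintro c z hci hz ⟨s, -, e⟩
    exact hz (root_aux hv0 hvinj _ _ (hdisj _ _ _ _ hci e))
  have main : ∀ (b : Fin k) (x : Fin (ℓ i + 1)) (y : Fin (ℓ b + 1)), i ≠ b →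
      (t2 : ℕ) < x → (y : ℕ) ≠ 0 →
      EdgeCoversIn T s(v i x, v b y) (PathEdge ℓ v i t1) := by
    intro b x y hib hx hy p q hpq w _
    have hin : ∃ s : Fin (ℓ i + 1), (t1 : ℕ) < s ∧ v i x = v i s := ⟨x, by omega, rfl⟩
    have hout := hidx b y (Ne.symm hib) hy
    rw [Sym2.eq_iff] at hpq
    rcases hpq with ⟨rfl, rfl⟩ | ⟨rfl, rfl⟩
    · exact cross_aux hv0 hvinj hdisj hAdj i t1 w hin hout
    · have := cross_aux hv0 hvinj hdisj hAdj i t1 w.reverse hin hout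
      simpa using this
  by_cases hA : a = i ∧ (t2 : ℕ) < x
  · obtain ⟨rfl, hA⟩ := hA
    exact main b x y hab hA hy
  by_cases hB : b = i ∧ (t2 : ℕ) < y
  · obtain ⟨rfl, hB⟩ := hB
    rw [Sym2.eq_swap]
    exact main a y x (Ne.symm hab) hB hx
  exfalso
  obtain ⟨p, hp⟩ := walk_aux hv0 hvinj hdisj hAdj i t2 a x x.2
    (fun e => by by_contra h; exact hA ⟨e, by omega⟩)
  obtain ⟨q, hq⟩ := walk_aux hv0 hvinj hdisj hAdj i t2 b y y.2
    (fun e => by by_contra h; exact hB ⟨e, by omega⟩)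
  have h := hc _ _ rfl (p.append q.reverse).bypass (SimpleGraph.Walk.bypass_isPath _)
  have h' := SimpleGraph.Walk.edges_bypass_subset _ h
  simp only [SimpleGraph.Walk.edges_append, List.mem_append, SimpleGraph.Walk.edges_reverse,
    List.mem_reverse] at h'
  tauto

end helpers

/-- In a star instance, let `e₁ = PathEdge ℓ v i t1` and `e₂ = PathEdge ℓ v i t2` be two
edges on the same path with `e₁` closer to the root (`t1 ≤ t2`), and let
`f = PathEdge ℓ v j tf` lie on a different path.  If `CrossCov(e₂, f) ≤ CrossCov(e₂)/10`
and `CrossCov(e₁, f) > CrossCov(e₁)/5`, then `CrossCov(e₁) ≥ (11/10)·CrossCov(e₂)`. -/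
theorem stmt10 [Fintype V] (G T : SimpleGraph V) (w : Sym2 V → ℝ)
    (hw : ∀ g ∈ G.edgeSet, 0 < w g)
    (hle : T ≤ G) (hT : T.IsTree)
    (r : V) (k : ℕ) (ℓ : Fin k → ℕ) (v : (i : Fin k) → Fin (ℓ i + 1) → V)
    (hv0 : ∀ i, v i 0 = r)
    (hvinj : ∀ i, Function.Injective (v i))
    (hdisj : ∀ i j x y, i ≠ j → v i x = v j y → v i x = r)
    (hAdj : ∀ x y : V, T.Adj x y ↔
      ∃ (i : Fin k) (t : Fin (ℓ i)), s(x, y) = PathEdge ℓ v i t)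
    (i j : Fin k) (hij : j ≠ i)
    (t1 t2 : Fin (ℓ i)) (h12 : t1 ≤ t2) (tf : Fin (ℓ j))
    (h2 : crossCov2 G T w ℓ v (PathEdge ℓ v i t2) (PathEdge ℓ v j tf) ≤
      crossCov1 G T w ℓ v (PathEdge ℓ v i t2) / 10)
    (h1 : crossCov2 G T w ℓ v (PathEdge ℓ v i t1) (PathEdge ℓ v j tf) >
      crossCov1 G T w ℓ v (PathEdge ℓ v i t1) / 5) :
    crossCov1 G T w ℓ v (PathEdge ℓ v i t1) ≥
      (11 / 10) * crossCov1 G T w ℓ v (PathEdge ℓ v i t2) := by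
  classical
  have hB : 0 ≤ crossCov1 G T w ℓ v (PathEdge ℓ v i t2) := by
    unfold crossCov1
    refine Finset.sum_nonneg fun g _ => ?_
    split_ifs with h
    · exact (hw g h.1).le
    · exact le_rfl
  have key : crossCov2 G T w ℓ v (PathEdge ℓ v i t1) (PathEdge ℓ v j tf) +
      crossCov1 G T w ℓ v (PathEdge ℓ v i t2) ≤
      crossCov2 G T w ℓ v (PathEdge ℓ v i t2) (PathEdge ℓ v j tf) +
      crossCov1 G T w ℓ v (PathEdge ℓ v i t1) := by
    unfold crossCov1 crossCov2
    rw [← Finset.sum_add_distrib, ← Finset.sum_add_distrib]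
    refine Finset.sum_le_sum fun g _ => ?_
    by_cases hgG : g ∈ G.edgeSet
    · by_cases hgc : IsCrossEdge ℓ v g
      · have hm := covers_mono hv0 hvinj hdisj hAdj i t1 t2 h12 g hgc
        have hpos := (hw g hgG).le
        by_cases c1 : EdgeCoversIn T g (PathEdge ℓ v i t1) <;>
        by_cases c2 : EdgeCoversIn T g (PathEdge ℓ v i t2) <;>
        by_cases c3 : EdgeCoversIn T g (PathEdge ℓ v j tf) <;>
        simp [hgG, hgc, c1, c2, c3, hpos] <;> exact absurd (hm c2) c1
      · simp [hgc]
    · simp [hgG]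
  linarith
end

section
/- (Combinatorial core of deterministic star-merging.) Let D be a finite directed graph on vertex set V in which every vertex has out-degree at most 1 and there are no self-loops (every arc u → v has u ≠ v). Let O ⊆ V be the set of vertices with out-degree exactly 1. Then there exists a partition V = R ⊔ J such that: (1) J ⊆ O; (2) 3·|J| ≥ |O|; and (3) for every v ∈ J, the head of the unique out-arc of v lies in R. -/
open Finset

theorem indep_aux {V : Type*} [DecidableEq V] (f : V → V) :
    ∀ (n : ℕ) (S : Finset V), S.card ≤ n → (∀ v ∈ S, f v ≠ v) →
      ∃ J ⊆ S, S.card ≤ 3 * J.card ∧ ∀ v ∈ J, f v ∉ J := by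
  intro n
  induction n with
  | zero =>
    intro S hS _
    exact ⟨∅, by simp, by simpa using hS, by simp⟩
  | succ n ih =>
    intro S hS hf
    rcases S.eq_empty_or_nonempty with rfl | hne
    · exact ⟨∅, by simp, by simp, by simp⟩
    obtain ⟨v, hv, hc⟩ := Finset.exists_card_fiber_le_of_card_le_mul (f := f) (s := S) (t := S)
      (n := 1) hne (by simp)
    set P := S.filter (fun x => f x = v) with hP
    set N : Finset V := insert v (insert (f v) P) with hN
    have hNc : N.card ≤ 3 := by
      have h1 : N.card ≤ _ := Finset.card_insert_le v (insert (f v) P)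
      have h2 := Finset.card_insert_le (f v) P
      omega
    have hlt : (S \ N).card < S.card := by
      apply Finset.card_lt_card
      refine ⟨Finset.sdiff_subset, fun h => ?_⟩
      have := h hv
      simp [hN] at this
    obtain ⟨J, hJS, hJc, hJ⟩ := ih (S \ N) (by omega)
      (fun u hu => hf u (Finset.mem_sdiff.1 hu).1)
    have hvJ : v ∉ J := fun h => by
      have := hJS h
      simp [hN] at this
    have hfvJ : f v ∉ J := fun h => by
      have := hJS h
      simp [hN] at this
    refine ⟨insert v J, ?_, ?_, ?_⟩
    · intro u hu
      rcases Finset.mem_insert.1 hu with rfl | hu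
      · exact hv
      · exact (Finset.mem_sdiff.1 (hJS hu)).1
    · rw [Finset.card_insert_of_notMem hvJ]
      have := Finset.le_card_sdiff N S
      omega
    · intro u hu hfu
      rcases Finset.mem_insert.1 hu with rfl | hu
      · rcases Finset.mem_insert.1 hfu with h | h
        · exact hf _ hv h
        · exact hfvJ h
      · rcases Finset.mem_insert.1 hfu with h | h
        · have := Finset.mem_sdiff.1 (hJS hu)
          apply this.2
          simp [hN, hP, this.1, h]
        · exact hJ u hu h

/-- Combinatorial core of deterministic star-merging.  `A` is the arc set of a finite
directed graph without self-loops in which every vertex has out-degree at most 1; `O`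
(expressed below as a filter) is the set of vertices of out-degree exactly 1.  There is a
partition `V = R ⊔ J` with `J ⊆ O`, `3·|J| ≥ |O|`, and every `v ∈ J` pointing into `R`. -/
theorem stmt13 {V : Type*} [Fintype V] [DecidableEq V]
    (A : Finset (V × V))
    (hloop : ∀ a ∈ A, a.1 ≠ a.2)
    (hdeg : ∀ v : V, (A.filter (fun a => a.1 = v)).card ≤ 1) :
    ∃ R J : Finset V,
      Disjoint R J ∧ R ∪ J = Finset.univ ∧
      (∀ v ∈ J, (A.filter (fun a => a.1 = v)).card = 1) ∧
      (Finset.univ.filter (fun v : V => (A.filter (fun a => a.1 = v)).card = 1)).card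
        ≤ 3 * J.card ∧
      (∀ v ∈ J, ∀ a ∈ A, a.1 = v → a.2 ∈ R) := by
  classical
  let f : V → V := fun v => if h : ∃ w, (v, w) ∈ A then h.choose else v
  have hfA : ∀ v w, (v, w) ∈ A → (v, f v) ∈ A := by
    intro v w h
    have h' : ∃ w, (v, w) ∈ A := ⟨w, h⟩
    simp only [f, dif_pos h']
    exact h'.choose_spec
  have hfu : ∀ v w, (v, w) ∈ A → w = f v := by
    intro v w h
    have := Finset.card_le_one.1 (hdeg v) (v, w) (by simp [h]) (v, f v) (by simp [hfA v w h])
    exact (Prod.mk.inj this).2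
  obtain ⟨J, hJO, hJc, hJ⟩ := indep_aux f _
    (Finset.univ.filter (fun v : V => (A.filter (fun a => a.1 = v)).card = 1)) le_rfl (by
      intro v hv
      have hv := (Finset.mem_filter.1 hv).2
      obtain ⟨a, ha⟩ := Finset.card_pos.1 (by omega : 0 < (A.filter (fun a => a.1 = v)).card)
      obtain ⟨haA, rfl⟩ := Finset.mem_filter.1 ha
      exact fun h => hloop _ (hfA a.1 a.2 haA) h.symm)
  refine ⟨Jᶜ, J, disjoint_compl_left, by ext x; simp [em'], fun v hv => (Finset.mem_filter.1 (hJO hv)).2,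
    hJc, ?_⟩
  rintro _ hv a ha rfl
  rw [hfu a.1 a.2 ha]
  exact Finset.mem_compl.2 (hJ _ hv)
end
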